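/- arXiv:2406.06217 — 4 statements merged into one kernel-verified Lean document; each statement's English description precedes it below -/
import Mathlib

section
/- Mignon–Ressayre lower bound: for every n ≥ 1 and every s ≥ 1, if A is an s×s matrix whose entries are affine-linear polynomials over ℂ in the n² variables x_{ij} and det(A) = PER_n as multivariate polynomials over ℂ, then 2s ≥ n² (i.e. the determinantal complexity of the n×n permanent is at least n²/2). -/
open MvPolynomial

/-- The permanent polynomial `PER_n = ∑_{σ ∈ S_n} ∏_i x_{i,σ(i)}` in the `n²`
variables `x_{ij}`, over ℂ. -/
noncomputable def permPoly (n : ℕ) : MvPolynomial (Fin n × Fin n) ℂ :=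
  ∑ σ : Equiv.Perm (Fin n), ∏ i, X (i, σ i)

open scoped Nat

/-- The Hessian matrix of a polynomial at a point. -/
noncomputable def hessianAt {σ K : Type*} [CommSemiring K] (x : σ → K) (f : MvPolynomial σ K) :
    Matrix σ σ K :=
  Matrix.of fun a b => eval x (pderiv a (pderiv b f))

theorem pderiv_eq_C_of_totalDegree_le_one {σ K : Type*} [CommSemiring K] {f : MvPolynomial σ K}
    (hf : f.totalDegree ≤ 1) (a : σ) : pderiv a f = C (coeff (Finsupp.single a 1) f) := by
  classical
  ext m
  rw [coeff_pderiv, coeff_C]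
  split_ifs with h
  · subst h; simp
  · rw [coeff_eq_zero_of_totalDegree_lt, zero_mul]
    have hm : m.degree ≠ 0 := fun h0 => h ((Finsupp.degree_eq_zero_iff m).1 h0).symm
    have : (m + Finsupp.single a 1).degree = m.degree + 1 := by simp
    change _ < (m + Finsupp.single a 1).degree
    omega

/-- The Hessian of the determinant of an affine-linear matrix has rank at most twice the size of
the matrix at every point where the determinant vanishes. -/
theorem rank_hessianAt_det_le {σ ι K : Type*} [Fintype σ] [Fintype ι] [DecidableEq ι] [Field K]
    (A : Matrix ι ι (MvPolynomial σ K)) (hA : ∀ p q, (A p q).totalDegree ≤ 1) (x : σ → K)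
    (hx : eval x A.det = 0) : (hessianAt x A.det).rank ≤ 2 * Fintype.card ι := by
  obtain ⟨w, hw0, hw⟩ : ∃ w : ι → K, w ≠ 0 ∧ ((eval x).mapMatrix A).mulVec w = 0 :=
    Matrix.exists_mulVec_eq_zero_iff.2 (by rw [← RingHom.map_det, hx])
  obtain ⟨i, hi⟩ := Function.ne_iff.1 hw0
  rw [Pi.zero_apply] at hi
  set y : ι → MvPolynomial σ K := A.mulVec fun q => C (w q) with hy
  have hyx (q) : eval x (y q) = 0 := by
    simpa [hy, Matrix.mulVec, dotProduct] using congrFun hw q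
  have hydeg (q) : (y q).totalDegree ≤ 1 := by
    refine totalDegree_finsetSum_le fun p _ => (totalDegree_mul _ _).trans ?_
    simpa using hA q p
  have hdet : A.det = C (w i)⁻¹ * ∑ q, A.adjugate i q * y q := by
    have h : A.adjugate.mulVec y = A.det • fun q => C (w q) := by
      rw [hy, Matrix.mulVec_mulVec, Matrix.adjugate_mul, Matrix.smul_mulVec, Matrix.one_mulVec]
    have h' : ∑ q, A.adjugate i q * y q = A.det * C (w i) := congrFun h i
    rw [h', mul_left_comm, ← C_mul, inv_mul_cancel₀ hi, C_1, mul_one]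
  let L : Matrix ι σ K := Matrix.of fun q a => coeff (Finsupp.single a 1) (y q)
  let M : Matrix ι σ K := Matrix.of fun q a => (w i)⁻¹ * eval x (pderiv a (A.adjugate i q))
  have hH : hessianAt x A.det = M.transpose * L + L.transpose * M := by
    ext a b
    rw [hessianAt, Matrix.of_apply, hdet]
    simp only [map_sum, pderiv_mul, map_add, map_mul, eval_C, hyx,
      pderiv_eq_C_of_totalDegree_le_one (hydeg _), pderiv_C, Matrix.add_apply, Matrix.mul_apply,
      Matrix.transpose_apply, L, M, Matrix.of_apply, Finset.mul_sum, ← Finset.sum_add_distrib]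
    refine Finset.sum_congr rfl fun q _ => ?_
    simp only [map_zero]
    ring
  rw [hH, ← Matrix.fromCols_mul_fromRows]
  refine (Matrix.rank_mul_le_right _ _).trans ((Matrix.rank_le_card_height _).trans_eq ?_)
  rw [Fintype.card_sum, two_mul]

/-- The number of permutations with prescribed values, given by an injection, on a finite set. -/
theorem card_perm_extending {α : Type*} [Fintype α] [DecidableEq α] (S : Finset α) (f : α → α)
    (hf : Set.InjOn f S) :
    (Finset.univ.filter fun σ : Equiv.Perm α => ∀ a ∈ S, σ a = f a).card
      = (Fintype.card α - S.card)! := by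
  obtain ⟨g, hg⟩ := Finset.exists_equiv_extend_of_card_eq (t := Finset.univ) (s := S) (f := f)
    (by simp) (by simp) hf
  let τ : Equiv.Perm α := g.trans (Equiv.subtypeUnivEquiv (by simp))
  have hτ : ∀ a ∈ S, τ a = f a := hg
  have e : Equiv.Perm {a // a ∉ S} ≃ {σ : Equiv.Perm α // ∀ a ∈ S, σ a = f a} :=
    (Equiv.Perm.subtypeEquivSubtypePerm (· ∉ S)).trans <|
      (Equiv.mulLeft τ).subtypeEquiv fun σ => by
        simp only [not_not, Equiv.coe_mulLeft, Equiv.Perm.mul_apply]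
        refine forall₂_congr fun a ha => ?_
        rw [← hτ a ha, τ.injective.eq_iff]
  rw [← Fintype.card_subtype, ← Fintype.card_congr e, Fintype.card_perm]
  simp [Fintype.card_subtype_compl]

theorem pderiv_prod_X {ι κ K : Type*} [CommSemiring K] [DecidableEq ι] [DecidableEq κ]
    (S : Finset ι) (σ : ι → κ) (a : ι × κ) :
    pderiv a (∏ m ∈ S, X (m, σ m) : MvPolynomial (ι × κ) K)
      = if a.1 ∈ S ∧ σ a.1 = a.2 then ∏ m ∈ S.erase a.1, X (m, σ m) else 0 := by
  induction S using Finset.induction_on with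
  | empty => simp
  | insert m S hm ih =>
    rw [Finset.prod_insert hm, pderiv_mul, ih, pderiv_X]
    obtain ⟨i, j⟩ := a
    by_cases h : i = m
    · subst h
      by_cases hj : σ i = j
      · simp [hm, hj]
      · simp [hm, hj]
    · have h' : m ∉ S.erase i := fun hh => hm (Finset.mem_of_mem_erase hh)
      simp [h, Finset.erase_insert_of_ne (Ne.symm h), Finset.prod_insert h',
        Ne.symm h]

/-- The all-ones matrix of size `n + 1` with its `(0, 0)` entry replaced by `-n`, which is a zero
of the permanent. -/
def permZero (n : ℕ) : Fin (n + 1) × Fin (n + 1) → ℂ :=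
  fun a => if a = 0 then -n else 1

theorem prod_permZero {n : ℕ} (S : Finset (Fin (n + 1))) (σ : Fin (n + 1) → Fin (n + 1)) :
    ∏ m ∈ S, permZero n (m, σ m) = 1 - (n + 1) * if 0 ∈ S ∧ σ 0 = 0 then 1 else 0 := by
  have h : ∀ m, permZero n (m, σ m) = if m = 0 then (if σ 0 = 0 then -(n : ℂ) else 1) else 1 := by
    intro m
    by_cases hm : m = 0
    · subst hm; simp [permZero, Prod.ext_iff]
    · simp [permZero, Prod.ext_iff, hm]
  simp only [h, Finset.prod_ite_eq']
  by_cases h0 : 0 ∈ S <;> by_cases h1 : σ 0 = 0 <;> simp [h0, h1]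

theorem eval_permZero_permPoly (n : ℕ) : eval (permZero n) (permPoly (n + 1)) = 0 := by
  have h := card_perm_extending ({0} : Finset (Fin (n + 1))) id (by simp)
  simp only [Finset.mem_singleton, forall_eq, id, Fintype.card_fin, Finset.card_singleton,
    Nat.add_sub_cancel] at h
  simp only [permPoly, map_sum, map_prod, eval_X, prod_permZero, Finset.mem_univ, true_and,
    Finset.sum_sub_distrib, ← Finset.mul_sum, Finset.sum_boole, h]
  simp [Fintype.card_perm, Nat.factorial_succ]

theorem hessianAt_permPoly_apply {n : ℕ} (i j k l : Fin (n + 1)) :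
    hessianAt (permZero n) (permPoly (n + 1)) (i, j) (k, l)
      = if i = k ∨ j = l then 0 else if i = 0 ∨ j = 0 ∨ k = 0 ∨ l = 0 then ((n - 1)! : ℂ)
        else (n - 1)! - (n + 1) * (n - 2)! := by
  have key : hessianAt (permZero n) (permPoly (n + 1)) (i, j) (k, l)
      = ∑ σ : Equiv.Perm (Fin (n + 1)), if i ≠ k ∧ σ i = j ∧ σ k = l then
        (1 - (n + 1) * if (i ≠ 0 ∧ k ≠ 0) ∧ σ 0 = 0 then 1 else 0 : ℂ) else 0 := by
    simp only [hessianAt, Matrix.of_apply, permPoly, map_sum]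
    refine Finset.sum_congr rfl fun σ _ => ?_
    rw [pderiv_prod_X]
    by_cases hk : σ k = l
    · simp only [hk, Finset.mem_univ, and_self, if_true, pderiv_prod_X, Finset.mem_erase, and_true]
      by_cases hi : i ≠ k ∧ σ i = j
      · rw [if_pos hi, if_pos hi, map_prod]
        simp only [eval_X, prod_permZero]
        simp [Finset.mem_erase, eq_comm]
      · rw [if_neg hi, if_neg hi, map_zero]
    · simp [hk]
  rw [key]
  by_cases hik : i = k
  · simp [hik]
  by_cases hjl : j = l
  · rw [if_pos (Or.inr hjl)]
    refine Finset.sum_eq_zero fun σ _ => if_neg ?_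
    rintro ⟨-, h1, h2⟩
    exact hik (σ.injective (by rw [h1, h2, hjl]))
  rw [if_neg (by tauto)]
  have c2 : (Finset.univ.filter fun σ : Equiv.Perm (Fin (n + 1)) => σ i = j ∧ σ k = l).card
      = (n - 1)! := by
    have h := card_perm_extending ({i, k} : Finset (Fin (n + 1))) (fun a => if a = i then j else l)
      (by intro a ha b hb; simp at ha hb; grind)
    rw [Finset.card_pair hik] at h
    simpa [Ne.symm hik] using h
  simp only [ne_eq, hik, not_false_eq_true, true_and, ← Finset.sum_filter, Finset.sum_sub_distrib,
    ← Finset.mul_sum]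
  simp only [Finset.sum_const, c2, Finset.filter_filter, nsmul_eq_mul, mul_one]
  split_ifs with h0
  · have : (Finset.univ.filter fun σ : Equiv.Perm (Fin (n + 1)) =>
        (σ i = j ∧ σ k = l) ∧ (¬i = 0 ∧ ¬k = 0) ∧ σ 0 = 0) = ∅ := by
      refine Finset.filter_eq_empty_iff.2 fun σ _ => ?_
      rintro ⟨⟨rfl, rfl⟩, ⟨hi, hk⟩, hσ⟩
      have hi' : σ i ≠ 0 := fun h => hi (σ.injective (h.trans hσ.symm))
      have hk' : σ k ≠ 0 := fun h => hk (σ.injective (h.trans hσ.symm))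
      tauto
    simp [this]
  · push Not at h0
    obtain ⟨hi, hj, hk, hl⟩ := h0
    have h := card_perm_extending ({0, i, k} : Finset (Fin (n + 1)))
      (fun a => if a = 0 then 0 else if a = i then j else l)
      (by intro a ha b hb; simp at ha hb; grind)
    have hc : ({0, i, k} : Finset (Fin (n + 1))).card = 3 :=
      Finset.card_eq_three.2 ⟨0, i, k, hi.symm, hk.symm, hik, rfl⟩
    rw [hc] at h
    have h' : (Finset.univ.filter fun σ : Equiv.Perm (Fin (n + 1)) =>
        (σ i = j ∧ σ k = l) ∧ (¬i = 0 ∧ ¬k = 0) ∧ σ 0 = 0).card = (n - 2)! := by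
      simp [Ne.symm hik, hi, hk] at h
      rw [← h]
      congr 1
      ext σ
      simp [hi, hk]
      tauto
    rw [h']

theorem det_hessianAt_permPoly_ne_zero {n : ℕ} (hn : 1 ≤ n) :
    (hessianAt (permZero n) (permPoly (n + 1))).det ≠ 0 := by
  intro hdet
  obtain ⟨u, hu0, hu⟩ := Matrix.exists_mulVec_eq_zero_iff.2 hdet
  refine hu0 ?_
  set f : ℂ := (((n - 1)! : ℕ) : ℂ) with hf
  set g : ℂ := (((n - 1)! : ℕ) : ℂ) - (n + 1) * (((n - 2)! : ℕ) : ℂ) with hg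
  have hf0 : f ≠ 0 := by simp [hf, Nat.factorial_ne_zero]
  have hn0 : (n : ℂ) ≠ 0 := by exact_mod_cast (by omega : n ≠ 0)
  have hg0 : g ≠ 0 := by
    obtain _ | _ | m := n
    · omega
    · simp [hg]
    · have : g = -2 * m ! := by
        simp [hg, Nat.factorial_succ]; ring
      rw [this]
      simp [Nat.factorial_ne_zero]
  have E : ∀ i j, ∑ k, ∑ l, (if i = k ∨ j = l then 0 else
      if i = 0 ∨ j = 0 ∨ k = 0 ∨ l = 0 then f else g) * u (k, l) = 0 := by
    intro i j
    have := congrFun hu (i, j)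
    simp only [Matrix.mulVec, dotProduct, Fintype.sum_prod_type, hessianAt_permPoly_apply] at this
    exact this
  set d := u (0, 0)
  set a : Fin n → ℂ := fun l => u (0, l.succ)
  set b : Fin n → ℂ := fun k => u (k.succ, 0)
  set U : Fin n → Fin n → ℂ := fun k l => u (k.succ, l.succ)
  have key (h : d = 0 ∧ a = 0 ∧ b = 0 ∧ U = 0) : u = 0 := by
    obtain ⟨hd, ha', hb', hU'⟩ := h
    ext ⟨k, l⟩
    refine Fin.cases ?_ (fun k => ?_) k <;> refine Fin.cases ?_ (fun l => ?_) l
    · exact hd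
    · exact congrFun ha' l
    · exact congrFun hb' k
    · exact congrFun (congrFun hU' k) l
  have drop₁ (i : Fin n) (c : ℂ) (v : Fin n → ℂ) :
      ∑ k, (if i = k then 0 else c) * v k = c * (∑ k, v k - v i) := by
    have : ∀ k, (if i = k then 0 else c) * v k = c * (v k - if i = k then v k else 0) := by
      intro k; split_ifs <;> ring
    simp only [this, ← Finset.mul_sum, Finset.sum_sub_distrib, Finset.sum_ite_eq,
      Finset.mem_univ, if_true]
  have drop₂ (i j : Fin n) (c : ℂ) (V : Fin n → Fin n → ℂ) :
      ∑ k, ∑ l, (if i = k ∨ j = l then 0 else c) * V k l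
        = c * (∑ k, ∑ l, V k l - ∑ l, V i l - (∑ k, V k j - V i j)) := by
    have : ∀ k l, (if i = k ∨ j = l then 0 else c) * V k l
        = (if i = k then 0 else c) * (V k l - if j = l then V k l else 0) := by
      intro k l; by_cases h : i = k <;> by_cases h' : j = l <;> simp [h, h']
    simp only [this, ← Finset.mul_sum, Finset.sum_sub_distrib, Finset.sum_ite_eq,
      Finset.mem_univ, if_true, drop₁]
    ring
  have hz : ∀ i : Fin n, (0 : Fin (n + 1)) ≠ i.succ := fun i => (Fin.succ_ne_zero i).symm
  have E00 : ∑ k, ∑ l, U k l = 0 := by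
    have := E 0 0
    simp only [Fin.sum_univ_succ, hz, true_or, or_true, or_self, if_true, if_false, zero_mul, zero_add,
      ← Finset.mul_sum] at this
    exact (mul_eq_zero.1 this).resolve_left hf0
  have E0 (j : Fin n) : ∑ k, b k - ∑ k, U k j = 0 := by
    have := E 0 j.succ
    simp only [Fin.sum_univ_succ, hz, true_or, or_self, if_true, if_false, zero_mul,
      Finset.sum_const_zero, zero_add, ← Finset.mul_sum, Fin.succ_ne_zero, false_or,
      Fin.succ_inj, drop₁, Finset.sum_add_distrib, Finset.sum_sub_distrib] at this
    change f * ∑ k, b k + f * (∑ k, ∑ l, U k l - ∑ k, U k j) = 0 at this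
    rw [E00, ← mul_add] at this
    linear_combination (mul_eq_zero.1 this).resolve_left hf0
  have E0' (i : Fin n) : ∑ l, a l - ∑ l, U i l = 0 := by
    have := E i.succ 0
    simp only [Fin.sum_univ_succ, hz, true_or, or_true, if_true, if_false, zero_mul, zero_add,
      ← Finset.mul_sum, Fin.succ_ne_zero, or_false, Fin.succ_inj, drop₁] at this
    change f * ∑ l, a l + f * (∑ k, ∑ l, U k l - ∑ l, U i l) = 0 at this
    rw [E00, ← mul_add] at this
    linear_combination (mul_eq_zero.1 this).resolve_left hf0
  have sb : ∑ k, b k = 0 := by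
    have h : ∑ j : Fin n, (∑ k, b k - ∑ k, U k j) = 0 := Finset.sum_eq_zero fun j _ => E0 j
    rw [Finset.sum_sub_distrib, Finset.sum_comm (f := fun j k => U k j), E00] at h
    simpa [hn0] using h
  have sa : ∑ l, a l = 0 := by
    have h : ∑ i : Fin n, (∑ l, a l - ∑ l, U i l) = 0 := Finset.sum_eq_zero fun i _ => E0' i
    rw [Finset.sum_sub_distrib, E00] at h
    simpa [hn0] using h
  have sU (j) : ∑ k, U k j = 0 := by simpa [sb] using E0 j
  have sU' (i) : ∑ l, U i l = 0 := by simpa [sa] using E0' i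
  have E1 (i j : Fin n) : f * (d - a j - b i) + g * U i j = 0 := by
    have := E i.succ j.succ
    simp only [Fin.sum_univ_succ, or_true, if_true, if_false, Fin.succ_ne_zero, false_or,
      or_false, Fin.succ_inj, drop₁, drop₂, Finset.sum_add_distrib] at this
    change f * d + f * (∑ k, b k - b i) + (f * (∑ l, a l - a j) +
      g * (∑ k, ∑ l, U k l - ∑ l, U i l - (∑ k, U k j - U i j))) = 0 at this
    rw [E00, sU, sU', sa, sb] at this
    linear_combination this
  have hbd (i) : d - b i = 0 := by
    have h : ∑ j, (f * (d - a j - b i) + g * U i j) = 0 := Finset.sum_eq_zero fun j _ => E1 i j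
    simp only [Finset.sum_add_distrib, ← Finset.mul_sum, Finset.sum_sub_distrib, sU', sa,
      Finset.sum_const, Finset.card_univ, Fintype.card_fin, nsmul_eq_mul] at h
    have h' : f * n * (d - b i) = 0 := by linear_combination h
    exact (mul_eq_zero.1 h').resolve_left (mul_ne_zero hf0 hn0)
  have hd : d = 0 := by
    have h : ∑ i, (d - b i) = 0 := Finset.sum_eq_zero fun i _ => hbd i
    simpa [Finset.sum_sub_distrib, sb, hn0] using h
  have hb0 (i) : b i = 0 := by linear_combination hd - hbd i
  have ha0 (j) : a j = 0 := by
    have h : ∑ i, (f * (d - a j - b i) + g * U i j) = 0 := Finset.sum_eq_zero fun i _ => E1 i j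
    simp only [Finset.sum_add_distrib, ← Finset.mul_sum, Finset.sum_sub_distrib, sU, sb, hd,
      Finset.sum_const, Finset.card_univ, Fintype.card_fin, nsmul_eq_mul] at h
    have h' : f * n * a j = 0 := by linear_combination -h
    exact (mul_eq_zero.1 h').resolve_left (mul_ne_zero hf0 hn0)
  refine key ⟨hd, funext ha0, funext hb0, funext₂ fun i j => ?_⟩
  have h := E1 i j
  rw [hd, ha0, hb0, sub_zero, sub_zero, mul_zero, zero_add] at h
  exact (mul_eq_zero.1 h).resolve_left hg0

/-- **Mignon–Ressayre lower bound**: if an `s × s` matrix `A` of affine-linear polynomials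
(over ℂ, in the variables `x_{ij}`) satisfies `det A = PER_n`, then `2s ≥ n²`; i.e. the
determinantal complexity of the `n × n` permanent is at least `n²/2`. -/
theorem mignon_ressayre {n s : ℕ} (hn : 1 ≤ n) (hs : 1 ≤ s)
    (A : Matrix (Fin s) (Fin s) (MvPolynomial (Fin n × Fin n) ℂ))
    (hA : ∀ p q, (A p q).totalDegree ≤ 1)
    (hdet : A.det = permPoly n) :
    n ^ 2 ≤ 2 * s := by
  obtain _ | _ | n := n
  · omega
  · omega
  have h := rank_hessianAt_det_le A hA (permZero (n + 1))
    (by rw [hdet]; exact eval_permZero_permPoly _)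
  rw [hdet, Matrix.rank_of_isUnit _ ((Matrix.isUnit_iff_isUnit_det _).2
    (isUnit_iff_ne_zero.2 (det_hessianAt_permPoly_ne_zero (by omega))))] at h
  simpa [sq] using h
end

section
/- Optimality for n = 3: for every s ≤ 6, there is no s×s matrix A whose entries are affine-linear polynomials over ℂ in the 9 variables x_{ij} (1 ≤ i,j ≤ 3) with det(A) = PER_3; that is, the determinantal complexity of the 3×3 permanent over ℂ equals 7. -/
open MvPolynomial

theorem Matrix.permanent_fin_three {R : Type*} [CommRing R] (x : Matrix (Fin 3) (Fin 3) R) :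
    x.permanent = x 0 0 * x 1 1 * x 2 2 + x 0 0 * x 1 2 * x 2 1 + x 0 1 * x 1 0 * x 2 2 +
      x 0 1 * x 1 2 * x 2 0 + x 0 2 * x 1 0 * x 2 1 + x 0 2 * x 1 1 * x 2 0 := by
  have : (Finset.univ : Finset (Equiv.Perm (Fin 3))) =
    {1, Equiv.swap 1 2, Equiv.swap 0 1, Equiv.swap 0 1 * Equiv.swap 1 2,
     Equiv.swap 0 1 * Equiv.swap 0 2, Equiv.swap 0 2} := by decide
  rw [permanent, this, Finset.sum_insert (by decide), Finset.sum_insert (by decide),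
    Finset.sum_insert (by decide), Finset.sum_insert (by decide), Finset.sum_insert (by decide),
    Finset.sum_singleton]
  simp [Fin.prod_univ_three, Equiv.swap_apply_def]
  ring

theorem permPoly_eq_permanent (n : ℕ) :
    permPoly n = (Matrix.of fun i j : Fin n => (X (i, j) : MvPolynomial _ ℂ)).permanent := by
  rw [← Matrix.permanent_transpose]
  rfl

theorem aeval_permPoly {n : ℕ} {S : Type*} [CommRing S] [Algebra ℂ S] (τ : S)
    (x : Matrix (Fin n) (Fin n) ℂ) :
    aeval (fun p : Fin n × Fin n => τ * algebraMap ℂ S (x p.1 p.2)) (permPoly n) =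
      τ ^ n * algebraMap ℂ S x.permanent := by
  rw [← Matrix.permanent_transpose, permPoly, Matrix.permanent]
  simp [Finset.prod_mul_distrib, Finset.mul_sum]

/-- A `7 × 7` matrix of affine-linear polynomials with determinant `permPoly 3`. -/
noncomputable def grenetMatrix : Matrix (Fin 7) (Fin 7) (MvPolynomial (Fin 3 × Fin 3) ℂ) :=
  (Matrix.fromBlocks
    !![0, X (0, 0), X (0, 1), X (0, 2);
       0, 1, 0, 0;
       0, 0, 1, 0;
       0, 0, 0, 1]
    !![0, 0, 0;
       X (1, 1), X (1, 2), 0;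
       X (1, 0), 0, X (1, 2);
       0, X (1, 0), X (1, 1)]
    !![X (2, 2), 0, 0, 0;
       X (2, 1), 0, 0, 0;
       X (2, 0), 0, 0, 0] 1).submatrix
    (finSumFinEquiv (m := 4) (n := 3)).symm (finSumFinEquiv (m := 4) (n := 3)).symm

theorem totalDegree_grenetMatrix (p q : Fin 7) : (grenetMatrix p q).totalDegree ≤ 1 := by
  obtain ⟨p, rfl⟩ := (finSumFinEquiv (m := 4) (n := 3)).surjective p
  obtain ⟨q, rfl⟩ := (finSumFinEquiv (m := 4) (n := 3)).surjective q
  rcases p with p | p <;> rcases q with q | q <;> fin_cases p <;> fin_cases q <;>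
    simp [grenetMatrix]

theorem det_grenetMatrix : grenetMatrix.det = permPoly 3 := by
  rw [permPoly_eq_permanent, Matrix.permanent_fin_three, grenetMatrix,
    Matrix.det_submatrix_equiv_self, Matrix.det_fromBlocks_one₂₂,
    Matrix.det_succ_column_zero]
  simp [Matrix.det_fin_three, Fin.sum_univ_succ, Fin.succAbove, Matrix.vecHead, Matrix.vecTail,
    Matrix.submatrix]
  ring

open Module Matrix

theorem finrank_le_of_dotProduct_eq_zero {K V ι : Type*} [Field K] [AddCommGroup V] [Module K V]
    [FiniteDimensional K V] [Fintype ι] (b c : V →ₗ[K] (ι → K)) (h : ∀ x, b x ⬝ᵥ c x = 0) :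
    finrank K V ≤ finrank K (LinearMap.ker (b.prod c)) + Fintype.card ι := by
  classical
  let B : LinearMap.BilinForm K ((ι → K) × (ι → K)) :=
    LinearMap.mk₂ K (fun p q => p.1 ⬝ᵥ q.2 + p.2 ⬝ᵥ q.1)
      (by intros; simp [add_dotProduct]; ring) (by intros; simp [mul_add])
      (by intros; simp [dotProduct_add]; ring) (by intros; simp [mul_add])
  have hB : B.Nondegenerate := by
    refine ⟨fun p hp => ?_, fun p hp => ?_⟩
    · ext i
      · simpa [B] using hp (0, Pi.single i 1)
      · simpa [B] using hp (Pi.single i 1, 0)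
    · ext i
      · simpa [B] using hp (0, Pi.single i 1)
      · simpa [B] using hp (Pi.single i 1, 0)
  have hU : LinearMap.range (b.prod c) ≤ B.orthogonal (LinearMap.range (b.prod c)) := by
    rintro _ ⟨x, rfl⟩ _ ⟨y, rfl⟩
    have h1 := h (x + y)
    simp only [map_add, add_dotProduct, dotProduct_add, h] at h1
    have : b y ⬝ᵥ c x + c y ⬝ᵥ b x = 0 := by
      rw [dotProduct_comm (c y)]; linear_combination h1
    simpa [B] using this
  have h1 := Submodule.finrank_mono hU
  rw [LinearMap.BilinForm.finrank_orthogonal hB] at h1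
  have h2 := LinearMap.finrank_range_add_finrank_ker (b.prod c)
  simp only [finrank_prod, finrank_fintype_fun_eq_card] at h1
  omega

theorem mul_mul_eq_zero_of_permanents {a b c a' b' c' : ℂ} (h1 : a * b' + b * a' = 0)
    (h2 : a * c' + c * a' = 0) (h3 : b * c' + c * b' = 0) : a * b' * c' = 0 := by
  linear_combination (c' * h1 - a' * h3 + b' * h2) / 2

theorem Fin.exists_third : ∀ k k' : Fin 3, k ≠ k' →
    ∃ i, i ≠ k ∧ i ≠ k' ∧ ∀ j, j = k ∨ j = k' ∨ j = i := by decide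

theorem exists_support_of_permanents_eq_zero (x : Matrix (Fin 3) (Fin 3) ℂ)
    (h : ∀ k l, x (k + 1) (l + 1) * x (k + 2) (l + 2) + x (k + 1) (l + 2) * x (k + 2) (l + 1) = 0) :
    (∃ i, ∀ k l, k ≠ i → x k l = 0) ∨ (∃ j, ∀ k l, l ≠ j → x k l = 0) ∨
      ∃ i j, ∀ k l, k = i ∨ l = j → x k l = 0 := by
  have hp : ∀ k k' l l', k ≠ k' → l ≠ l' → x k l * x k' l' + x k l' * x k' l = 0 := by
    intro k k' l l' hk hl
    have h1 := fun i j => h i j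
    simp only [Fin.forall_fin_succ, Fin.isValue, Fin.reduceAdd, Fin.reduceSucc] at h1
    fin_cases k <;> fin_cases k' <;> first | exact absurd rfl hk | skip
    all_goals fin_cases l <;> fin_cases l' <;> first | exact absurd rfl hl | (simp at h1 ⊢; grind)
  clear h
  by_cases hx : ∃ k k' l l', k ≠ k' ∧ l ≠ l' ∧ x k l ≠ 0 ∧ x k' l' ≠ 0
  · obtain ⟨k, k', l, l', hk, hl, h1, h2⟩ := hx
    obtain ⟨k'', hk1, hk2, hk3⟩ := Fin.exists_third k k' hk
    obtain ⟨l'', hl1, hl2, hl3⟩ := Fin.exists_third l l' hl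
    have := hp k k' l l' hk hl
    have h3 : x k l' ≠ 0 := by grind
    have h4 : x k' l ≠ 0 := by grind
    have row : ∀ a b, a ≠ b → x b l ≠ 0 → x b l' ≠ 0 → x a l'' = 0 := by
      intro a b hab hb hb'
      have := mul_mul_eq_zero_of_permanents (hp a b l'' l hab hl1) (hp a b l'' l' hab hl2)
        (hp a b l l' hab hl)
      grind
    have col : ∀ a b, a ≠ b → x k b ≠ 0 → x k' b ≠ 0 → x k'' a = 0 := by
      intro a b hab hb hb'
      have := mul_mul_eq_zero_of_permanents (a := x k'' a) (a' := x k'' b) (b := x k a)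
        (b' := x k b) (c := x k' a) (c' := x k' b)
        (by linear_combination hp k'' k a b hk1 hab) (by linear_combination hp k'' k' a b hk2 hab)
        (by linear_combination hp k k' a b hk hab)
      grind
    refine Or.inr (Or.inr ⟨k'', l'', fun a b hab => ?_⟩)
    have r1 := row k k' hk h4 h2
    have r2 := row k' k hk.symm h1 h3
    have r3 := row k'' k hk1 h1 h3
    have c1 := col l l' hl h3 h2
    have c2 := col l' l hl.symm h1 h4
    rcases hk3 a with rfl | rfl | rfl <;> rcases hl3 b with rfl | rfl | rfl <;> grind
  · push Not at hx
    by_cases h0 : ∃ k l, x k l ≠ 0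
    · obtain ⟨k, l, hkl⟩ := h0
      by_cases h1 : ∃ k', k' ≠ k ∧ x k' l ≠ 0
      · obtain ⟨k', hk', h2⟩ := h1
        refine Or.inr (Or.inl ⟨l, fun a b hb => ?_⟩)
        by_cases ha : a = k
        · exact hx k' a l b (by grind) hb.symm h2
        · exact hx k a l b (Ne.symm ha) hb.symm hkl
      · push Not at h1
        refine Or.inl ⟨k, fun a b ha => ?_⟩
        by_cases hb : b = l
        · exact hb ▸ h1 a ha
        · exact hx k a l b ha.symm (Ne.symm hb) hkl
    · push Not at h0
      exact Or.inl ⟨0, fun k l _ => h0 k l⟩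

theorem finrank_le_three_of_permanents_eq_zero (W : Submodule ℂ (Matrix (Fin 3) (Fin 3) ℂ))
    (h : ∀ x ∈ W, ∀ k l,
      x (k + 1) (l + 1) * x (k + 2) (l + 2) + x (k + 1) (l + 2) * x (k + 2) (l + 1) = 0) :
    finrank ℂ W ≤ 3 := by
  let S : (Fin 3 ⊕ Fin 3 ⊕ Fin 3 × Fin 3) → Submodule ℂ W := fun s =>
    match s with
    | .inl i =>
      { carrier := {x | ∀ k l, k ≠ i → x.1 k l = 0}
        add_mem' := fun hx hy k l hk => by simp [hx k l hk, hy k l hk]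
        zero_mem' := by simp
        smul_mem' := fun c x hx k l hk => by simp [hx k l hk] }
    | .inr (.inl j) =>
      { carrier := {x | ∀ k l, l ≠ j → x.1 k l = 0}
        add_mem' := fun hx hy k l hk => by simp [hx k l hk, hy k l hk]
        zero_mem' := by simp
        smul_mem' := fun c x hx k l hk => by simp [hx k l hk] }
    | .inr (.inr (i, j)) =>
      { carrier := {x | ∀ k l, k = i ∨ l = j → x.1 k l = 0}
        add_mem' := fun hx hy k l hk => by simp [hx k l hk, hy k l hk]
        zero_mem' := by simp
        smul_mem' := fun c x hx k l hk => by simp [hx k l hk] }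
  obtain ⟨s, hs⟩ := Subspace.exists_eq_top_of_iUnion_eq_univ (p := S) (by
    refine Set.eq_univ_of_forall fun x => Set.mem_iUnion.2 ?_
    rcases exists_support_of_permanents_eq_zero x.1 (h x.1 x.2) with ⟨i, hi⟩ | ⟨j, hj⟩ | ⟨i, j, hij⟩
    · exact ⟨.inl i, hi⟩
    · exact ⟨.inr (.inl j), hj⟩
    · exact ⟨.inr (.inr (i, j)), hij⟩)
  have hS : ∀ x : W, x ∈ S s := fun x => hs ▸ Submodule.mem_top
  rcases s with i | j | ⟨i, j⟩
  · let f : W →ₗ[ℂ] (Fin 3 → ℂ) := (LinearMap.proj i).comp W.subtype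
    have hf : Function.Injective f := by
      refine (injective_iff_map_eq_zero f).2 fun x hx => Subtype.ext (Matrix.ext fun k l => ?_)
      by_cases hk : k = i
      · exact hk ▸ congrFun hx l
      · exact hS x k l hk
    simpa using LinearMap.finrank_le_finrank_of_injective hf
  · let f : W →ₗ[ℂ] (Fin 3 → ℂ) :=
      ((LinearMap.proj j).comp (Matrix.transposeLinearEquiv _ _ ℂ ℂ).toLinearMap).comp W.subtype
    have hf : Function.Injective f := by
      refine (injective_iff_map_eq_zero f).2 fun x hx => Subtype.ext (Matrix.ext fun k l => ?_)
      by_cases hl : l = j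
      · exact hl ▸ congrFun hx k
      · exact hS x k l hl
    simpa using LinearMap.finrank_le_finrank_of_injective hf
  · by_contra! h4
    let f : W →ₗ[ℂ] (Fin 2 × Fin 2 → ℂ) :=
      (LinearMap.pi fun p => Matrix.entryLinearMap ℂ ℂ (i.succAbove p.1) (j.succAbove p.2)).comp
        W.subtype
    have hf : Function.Injective f := by
      refine (injective_iff_map_eq_zero f).2 fun x hx => Subtype.ext (Matrix.ext fun k l => ?_)
      by_cases hk : k = i
      · exact hS x k l (.inl hk)
      by_cases hl : l = j
      · exact hS x k l (.inr hl)
      obtain ⟨k, rfl⟩ := Fin.exists_succAbove_eq hk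
      obtain ⟨l, rfl⟩ := Fin.exists_succAbove_eq hl
      exact congrFun hx (k, l)
    have h5 : finrank ℂ W = finrank ℂ (Fin 2 × Fin 2 → ℂ) :=
      le_antisymm (LinearMap.finrank_le_finrank_of_injective hf) (by simpa using Nat.succ_le_of_lt h4)
    obtain ⟨x, hx⟩ := (LinearMap.injective_iff_surjective_of_finrank_eq_finrank h5).1 hf
      (fun p => if p.1 = p.2 then 1 else 0)
    have e : ∀ p q, x.1 (i.succAbove p) (j.succAbove q) = if p = q then 1 else 0 :=
      fun p q => congrFun hx (p, q)
    have h1 := h x.1 x.2 i j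
    have e00 := e 0 0
    have e01 := e 0 1
    have e10 := e 1 0
    have e11 := e 1 1
    fin_cases i <;> fin_cases j <;> simp [Fin.succAbove] at e00 e01 e10 e11 h1 <;> simp [*] at h1

/-- The matrix with first row `v` and zeros elsewhere. -/
def firstRow (v : Fin 3 → ℂ) : Matrix (Fin 3) (Fin 3) ℂ := Matrix.of ![v, 0, 0]

/-- The linear map sending `y` to the three `2 × 2` permanents of the matrix with rows `v` and `y`. -/
def permanentForm (v : Fin 3 → ℂ) : (Fin 3 → ℂ) →ₗ[ℂ] (Fin 3 → ℂ) where
  toFun y := ![v 2 * y 1 + v 1 * y 2, v 2 * y 0 + v 0 * y 2, v 1 * y 0 + v 0 * y 1]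
  map_add' y z := by ext i; fin_cases i <;> simp <;> ring
  map_smul' c y := by ext i; fin_cases i <;> simp <;> ring

theorem permanent_firstRow_add (v : Fin 3 → ℂ) (y : Matrix (Fin 3) (Fin 3) ℂ) :
    (firstRow v + y).permanent = y.permanent + y 1 ⬝ᵥ permanentForm v (y 2) := by
  simp [Matrix.permanent_fin_three, firstRow, permanentForm, dotProduct, Fin.sum_univ_three]
  ring

theorem permanentForm_injOn {v y : Fin 3 → ℂ} {i : Fin 3} (hv : v i ≠ 0) (hy : y i = 0)
    (h : permanentForm v y = 0) : y = 0 := by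
  have h0 := congrFun h 0
  have h1 := congrFun h 1
  have h2 := congrFun h 2
  ext j
  fin_cases i <;> fin_cases j <;> simp_all [permanentForm]

/-- The `i`-th row of a matrix, as a linear map. -/
def rowMap (i : Fin 3) : Matrix (Fin 3) (Fin 3) ℂ →ₗ[ℂ] (Fin 3 → ℂ) where
  toFun x := x i
  map_add' _ _ := rfl
  map_smul' _ _ := rfl

theorem exists_finrank_four_of_firstRow_mem {W : Submodule ℂ (Matrix (Fin 3) (Fin 3) ℂ)}
    (hW : ∀ x ∈ W, x.permanent = 0) (h7 : 7 ≤ finrank ℂ W) {v : Fin 3 → ℂ}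
    (hv : firstRow v ∈ W) :
    ∃ K ≤ W, 4 ≤ finrank ℂ K ∧ ∀ y ∈ K, y 1 = 0 ∧ permanentForm v (y 2) = 0 := by
  let b : W →ₗ[ℂ] (Fin 3 → ℂ) := (rowMap 1).comp W.subtype
  let c : W →ₗ[ℂ] (Fin 3 → ℂ) := (permanentForm v).comp ((rowMap 2).comp W.subtype)
  have h := finrank_le_of_dotProduct_eq_zero b c fun y => by
    have h1 := permanent_firstRow_add v y.1
    rw [hW _ (W.add_mem hv y.2), hW _ y.2, zero_add] at h1
    exact h1.symm
  rw [Fintype.card_fin] at h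
  refine ⟨(LinearMap.ker (b.prod c)).map W.subtype, Submodule.map_subtype_le _ _, ?_, ?_⟩
  · rw [Submodule.finrank_map_subtype_eq]
    omega
  · rintro _ ⟨y, hy, rfl⟩
    exact ⟨congrArg Prod.fst hy, congrArg Prod.snd hy⟩

theorem finrank_le_six_of_permanent_eq_zero (W : Submodule ℂ (Matrix (Fin 3) (Fin 3) ℂ))
    (hW : ∀ x ∈ W, x.permanent = 0) : finrank ℂ W ≤ 6 := by
  by_contra! h7
  obtain ⟨v, hv0, hv⟩ : ∃ v, v ≠ 0 ∧ firstRow v ∈ W := by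
    let f : W →ₗ[ℂ] (Fin 2 × Fin 3 → ℂ) :=
      (LinearMap.pi fun p => Matrix.entryLinearMap ℂ ℂ p.1.succ p.2).comp W.subtype
    obtain ⟨x, hx, hx0⟩ := (Submodule.ne_bot_iff _).1
      (LinearMap.ker_ne_bot_of_finrank_lt (f := f) (by simpa using h7))
    have hx1 : firstRow (x.1 0) = x.1 := by
      ext i j
      refine Fin.cases rfl (fun i => ?_) i
      have := congrFun hx (i, j)
      fin_cases i <;> exact this.symm
    refine ⟨x.1 0, fun h => hx0 (Subtype.ext ?_), hx1 ▸ x.2⟩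
    rw [← hx1, h]
    ext i j
    fin_cases i <;> simp [firstRow]
  obtain ⟨i, hi⟩ := Function.ne_iff.1 hv0
  have h1 : firstRow 1 ∈ W := by
    obtain ⟨K, hKW, hK4, hK⟩ := exists_finrank_four_of_firstRow_mem hW h7 hv
    have hrow : ∀ x ∈ K, x 2 i = 0 → x = firstRow (x 0) := fun x hx hx2 => by
      have h2 := permanentForm_injOn hi hx2 (hK x hx).2
      ext k l
      fin_cases k
      · rfl
      · exact congrFun (hK x hx).1 l
      · exact congrFun h2 l
    let g : K →ₗ[ℂ] (Fin 3 → ℂ) × ℂ :=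
      ((rowMap 0).prod (Matrix.entryLinearMap ℂ ℂ 2 i)).comp K.subtype
    have hg : Function.Injective g := by
      refine (injective_iff_map_eq_zero g).2 fun x hx => Subtype.ext ?_
      rw [hrow x.1 x.2 (congrArg Prod.snd hx), show x.1 0 = 0 from congrArg Prod.fst hx]
      ext k l
      fin_cases k <;> rfl
    have h5 : finrank ℂ K = finrank ℂ ((Fin 3 → ℂ) × ℂ) :=
      le_antisymm (LinearMap.finrank_le_finrank_of_injective hg) (by simpa using hK4)
    obtain ⟨x, hx⟩ := (LinearMap.injective_iff_surjective_of_finrank_eq_finrank h5).1 hg (1, 0)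
    have h2 := hrow x.1 x.2 (congrArg Prod.snd hx)
    rw [show x.1 0 = 1 from congrArg Prod.fst hx] at h2
    exact h2 ▸ hKW x.2
  obtain ⟨K, -, hK4, hK⟩ := exists_finrank_four_of_firstRow_mem hW h7 h1
  have hg : Function.Injective ((rowMap 0).comp K.subtype) := by
    refine (injective_iff_map_eq_zero _).2 fun x hx => Subtype.ext ?_
    have h2 := (hK x.1 x.2).2
    have e0 := congrFun h2 0
    have e1 := congrFun h2 1
    have e2 := congrFun h2 2
    simp [permanentForm] at e0 e1 e2
    have h3 : x.1 2 0 = 0 := by linear_combination (e1 + e2 - e0) / 2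
    ext k l
    fin_cases k
    · exact congrFun hx l
    · exact congrFun (hK x.1 x.2).1 l
    · exact congrFun (permanentForm_injOn (i := 0) one_ne_zero h3 h2) l
  have := LinearMap.finrank_le_finrank_of_injective hg
  simp at this
  omega

/-- The polarization of a cubic form. -/
def polarization {V : Type*} [AddCommGroup V] (f : V → ℂ) (x y z : V) : ℂ :=
  f (x + y + z) - f (x + y) - f (x + z) - f (y + z) + f x + f y + f z

theorem permanent_add_smul_single (x : Matrix (Fin 3) (Fin 3) ℂ) (t : ℂ) (k l : Fin 3) :
    (x + t • single k l 1).permanent = x.permanent + t *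
      (x (k + 1) (l + 1) * x (k + 2) (l + 2) + x (k + 1) (l + 2) * x (k + 2) (l + 1)) := by
  fin_cases k <;> fin_cases l <;> simp [permanent_fin_three] <;> ring

theorem det_add_smul_single (x : Matrix (Fin 3) (Fin 3) ℂ) (t : ℂ) (k l : Fin 3) :
    (x + t • single k l 1).det = x.det + t *
      (x (k + 1) (l + 1) * x (k + 2) (l + 2) - x (k + 1) (l + 2) * x (k + 2) (l + 1)) := by
  fin_cases k <;> fin_cases l <;> simp [det_fin_three] <;> ring

theorem eq_zero_of_permanent_add_eq {x : Matrix (Fin 3) (Fin 3) ℂ}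
    (h : ∀ y, (y + x).permanent = y.permanent) : x = 0 := by
  ext k l
  have h0 := h 0
  have h1 := h (single (k + 1) (l + 1) 1)
  have h2 := h (single (k + 2) (l + 2) 1)
  have h3 := h (single (k + 1) (l + 1) 1 + single (k + 2) (l + 2) 1)
  fin_cases k <;> fin_cases l <;>
    simp [permanent_fin_three] at h0 h1 h2 h3 ⊢ <;>
    linear_combination h3 - h2 - h1 + h0

theorem polarization_det_eq_zero {a b : Matrix (Fin 3) (Fin 3) ℂ} (h0 : a 0 0 ≠ 0)
    (ha : ∀ k l, a (k + 1) (l + 1) * a (k + 2) (l + 2) - a (k + 1) (l + 2) * a (k + 2) (l + 1) = 0)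
    (hb : ∀ i j : Fin 2, a 0 0 * b i.succ j.succ + a i.succ j.succ * b 0 0 -
      a i.succ 0 * b 0 j.succ - a 0 j.succ * b i.succ 0 = 0) (c : Matrix (Fin 3) (Fin 3) ℂ) :
    polarization det a b c = 0 := by
  have ea : ∀ i j : Fin 2, a i.succ j.succ = a i.succ 0 * a 0 j.succ / a 0 0 := by
    intro i j
    rw [eq_div_iff h0]
    simp [Fin.forall_fin_succ] at ha
    fin_cases i <;> fin_cases j <;> simp <;> grind
  have eb : ∀ i j : Fin 2, b i.succ j.succ = (a i.succ 0 * b 0 j.succ + a 0 j.succ * b i.succ 0 -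
      a i.succ j.succ * b 0 0) / a 0 0 := by
    intro i j
    rw [eq_div_iff h0]
    linear_combination hb i j
  simp [Fin.forall_fin_succ, ea] at eb
  simp [Fin.forall_fin_succ] at ea
  obtain ⟨⟨a11, a12⟩, a21, a22⟩ := ea
  obtain ⟨⟨b11, b12⟩, b21, b22⟩ := eb
  simp only [polarization, det_fin_three, Matrix.add_apply, a11, a12, a21, a22, b11, b12, b21, b22]
  field_simp
  ring

theorem det_submatrix_add_right (x : Matrix (Fin 3) (Fin 3) ℂ) (p q : Fin 3) :
    (x.submatrix (· + p) (· + q)).det = x.det := by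
  fin_cases p <;> fin_cases q <;> simp [det_fin_three] <;> ring

theorem permanent_ne_smul_det (a : Matrix (Fin 3) (Fin 3) ℂ →ₗ[ℂ] Matrix (Fin 3) (Fin 3) ℂ)
    {d : ℂ} (hd : d ≠ 0) (h : ∀ x, (a x).det = d * x.permanent) : False := by
  have inj : ∀ x, a x = 0 → x = 0 := fun x hx => eq_zero_of_permanent_add_eq fun y =>
    mul_left_cancel₀ hd (by rw [← h, ← h, map_add, hx, add_zero])
  have x0 : firstRow 1 ≠ 0 := fun hx => one_ne_zero (α := ℂ) (congrFun (congrFun hx 0) 0)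
  obtain ⟨p, q, hpq⟩ : ∃ p q, a (firstRow 1) p q ≠ 0 := by
    by_contra! h1
    exact x0 (inj _ (Matrix.ext h1))
  let σ : Matrix (Fin 3) (Fin 3) ℂ →ₗ[ℂ] Matrix (Fin 3) (Fin 3) ℂ :=
    { toFun := fun x => x.submatrix (· + p) (· + q)
      map_add' := fun _ _ => rfl
      map_smul' := fun _ _ => rfl }
  have hσ : ∀ x, σ x = 0 → x = 0 := fun x hx => Matrix.ext fun i j => by
    have := congrFun (congrFun hx (i - p)) (j - q)
    change x (i - p + p) (j - q + q) = 0 at this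
    rwa [sub_add_cancel, sub_add_cancel] at this
  let f := σ.comp a
  have hf : ∀ x, (f x).det = d * x.permanent := fun x => (det_submatrix_add_right _ _ _).trans (h x)
  have hinj : Function.Injective f :=
    (injective_iff_map_eq_zero f).2 fun x hx => inj x (hσ _ hx)
  have hf0 : f (firstRow 1) 0 0 ≠ 0 := by
    change a (firstRow 1) (0 + p) (0 + q) ≠ 0
    rwa [zero_add, zero_add]
  have hminor : ∀ k l, f (firstRow 1) (k + 1) (l + 1) * f (firstRow 1) (k + 2) (l + 2) -
      f (firstRow 1) (k + 1) (l + 2) * f (firstRow 1) (k + 2) (l + 1) = 0 := by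
    intro k l
    obtain ⟨y, hy⟩ := LinearMap.injective_iff_surjective.1 hinj (single k l 1)
    have h1 := fun t : ℂ => det_add_smul_single (f (firstRow 1)) t k l
    simp only [← hy, ← map_smul, ← map_add, hf] at h1
    have h2 : ∀ t : ℂ, (t • y).permanent = t ^ 3 * y.permanent := fun t => by
      simp [permanent_smul]
    have h0 : (firstRow 1).permanent = 0 := by simp [permanent_fin_three, firstRow]
    have h3 : ∀ (t : ℂ) i, (t • y) i = t • y i := fun _ _ => rfl
    simp only [permanent_firstRow_add, h2, h0, h3, map_smul, smul_dotProduct, dotProduct_smul,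
      smul_eq_mul] at h1
    have e1 := h1 1
    have e2 := h1 (-1)
    have e3 := h1 2
    linear_combination (e3 - 6 * e1 + 2 * e2) / 6
  let m : Matrix (Fin 3) (Fin 3) ℂ →ₗ[ℂ] (Fin 2 × Fin 2 → ℂ) :=
    { toFun := fun y p => f (firstRow 1) 0 0 * f y p.1.succ p.2.succ +
        f (firstRow 1) p.1.succ p.2.succ * f y 0 0 - f (firstRow 1) p.1.succ 0 * f y 0 p.2.succ -
        f (firstRow 1) 0 p.2.succ * f y p.1.succ 0
      map_add' := fun y z => by ext; simp; ring
      map_smul' := fun c y => by ext; simp; ring }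
  have hker : ∀ y ∈ LinearMap.ker m, y 1 = 0 ∧ y 2 = 0 := by
    intro y hy
    have h1 : ∀ z, polarization permanent (firstRow 1) y z = 0 := fun z => by
      have := polarization_det_eq_zero hf0 hminor (fun i j => congrFun hy (i, j)) (f z)
      simp only [polarization, ← map_add, hf] at this ⊢
      exact mul_left_cancel₀ hd (by linear_combination this)
    have h2 : ∀ k l, polarization permanent (firstRow 1) y (single k l 1) = 0 := fun k l => h1 _
    simp [polarization, permanent_fin_three, firstRow, Fin.forall_fin_succ, single_apply] at h2
    obtain ⟨-, ⟨e0, e1, e2⟩, e3, e4, e5⟩ := h2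
    constructor <;> ext i <;> fin_cases i <;> simp <;> grind
  have h5 := LinearMap.finrank_range_add_finrank_ker m
  have h4 := (LinearMap.range m).finrank_le
  let g : LinearMap.ker m →ₗ[ℂ] (Fin 3 → ℂ) := (rowMap 0).comp (LinearMap.ker m).subtype
  have hg : Function.Injective g := by
    refine (injective_iff_map_eq_zero g).2 fun x hx => Subtype.ext ?_
    ext k l
    fin_cases k
    · exact congrFun hx l
    · exact congrFun (hker x.1 x.2).1 l
    · exact congrFun (hker x.1 x.2).2 l
  have h3 := LinearMap.finrank_le_finrank_of_injective hg
  simp [finrank_matrix] at h3 h4 h5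
  omega

theorem MvPolynomial.eq_C_add_sum_of_totalDegree_le_one {σ R : Type*} [Fintype σ] [CommSemiring R]
    {p : MvPolynomial σ R} (hp : p.totalDegree ≤ 1) :
    p = C (coeff 0 p) + ∑ i, C (coeff (Finsupp.single i 1) p) * X i := by
  classical
  ext m
  by_cases hm : m.degree ≤ 1
  · rcases Nat.le_one_iff_eq_zero_or_eq_one.1 hm with h0 | h1
    · obtain rfl := (Finsupp.degree_eq_zero_iff m).1 h0
      simp [coeff_sum]
    · obtain ⟨i, hi⟩ : m ∈ Set.range fun i : σ => Finsupp.single i 1 := by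
        rw [Finsupp.range_single_one]; exact h1
      obtain rfl : Finsupp.single i 1 = m := hi
      have h2 : (0 : σ →₀ ℕ) ≠ Finsupp.single i 1 := (Finsupp.single_ne_zero.2 one_ne_zero).symm
      simp [coeff_sum, coeff_C_mul, coeff_X, Finsupp.single_left_inj, coeff_C, h2]
  · have h0 : m ≠ 0 := by rintro rfl; simp at hm
    have h1 : ∀ i, Finsupp.single i 1 ≠ m := by rintro i rfl; simp at hm
    rw [coeff_eq_zero_of_totalDegree_lt (hp.trans_lt (not_le.1 hm))]
    simp [coeff_sum, coeff_C_mul, coeff_C, coeff_X, h0.symm, h1]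

theorem MvPolynomial.aeval_mul_algebraMap_of_totalDegree_le_one {σ R S : Type*} [Fintype σ]
    [CommRing R] [CommRing S] [Algebra R S] (τ : S) (x : σ → R) {p : MvPolynomial σ R}
    (hp : p.totalDegree ≤ 1) :
    aeval (fun i => τ * algebraMap R S (x i)) p = algebraMap R S (coeff 0 p) +
      τ * algebraMap R S (∑ i, coeff (Finsupp.single i 1) p * x i) := by
  conv_lhs => rw [eq_C_add_sum_of_totalDegree_le_one hp]
  simp only [map_add, map_sum, map_mul, aeval_C, aeval_X, Finset.mul_sum]
  refine congrArg _ (Finset.sum_congr rfl fun i _ => by ring)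

theorem det_fromBlocks_one_add_smul {R m n : Type*} [CommRing R] [Fintype m] [Fintype n]
    [DecidableEq m] [DecidableEq n] {τ : R} (hτ : τ ^ 4 = 0) (D : Matrix m m R) (B : Matrix m n R)
    (C : Matrix n m R) (E : Matrix n n R) {d : R}
    (h : (fromBlocks (1 + τ • D) (τ • B) (τ • C) (τ • E)).det = d * τ ^ 3) :
    d * τ ^ 3 = τ ^ Fintype.card n *
      (E - τ • (C * B) + τ ^ 2 • (C * D * B) - τ ^ 3 • (C * D * D * B)).det := by
  let P := τ • D
  have hP : P ^ 4 = 0 := by rw [smul_pow, hτ, zero_smul]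
  have hN : (1 + P) * (1 - P + P ^ 2 - P ^ 3) = 1 := by
    have : (1 + P) * (1 - P + P ^ 2 - P ^ 3) = 1 - P ^ 4 := by noncomm_ring
    rw [this, hP, sub_zero]
  let _ : Invertible (1 + τ • D) := invertibleOfRightInverse _ _ hN
  rw [det_fromBlocks₁₁, det_one_add_smul] at h
  have h1 : τ • E - τ • C * ⅟(1 + τ • D) * τ • B =
      τ • (E - τ • (C * B) + τ ^ 2 • (C * D * B) - τ ^ 3 • (C * D * D * B)) := by
    have h2 : ⅟(1 + τ • D) = 1 - τ • D + (τ • D) ^ 2 - (τ • D) ^ 3 := rfl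
    rw [h2, smul_pow, smul_pow, pow_succ D 2, pow_two D]
    simp only [Matrix.smul_mul, Matrix.mul_smul, Matrix.mul_sub, Matrix.mul_add, Matrix.sub_mul,
      Matrix.add_mul, Matrix.mul_one, ← Matrix.mul_assoc]
    rw [← sub_eq_zero]
    simp only [smul_sub, smul_add, smul_smul]
    have h5 : (τ * τ ^ 3 * τ) • (C * D * D * D * B) = 0 := by
      rw [← pow_succ', hτ, zero_mul, zero_smul]
    refine Eq.trans ?_ h5
    module
  rw [h1, det_smul] at h
  generalize (det (1 + (Polynomial.X : Polynomial R) • D.map Polynomial.C)).divX.divX.eval τ = w at h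
  generalize τ ^ Fintype.card n *
    (E - τ • (C * B) + τ ^ 2 • (C * D * B) - τ ^ 3 • (C * D * D * B)).det = G at h ⊢
  obtain ⟨u, hu⟩ : ∃ u, u = trace D + w * τ := ⟨_, rfl⟩
  have h4 : (1 + τ * u) * G = d * τ ^ 3 := by rw [← h, hu]; ring
  linear_combination (-(1 - τ * u + τ ^ 2 * u ^ 2 - τ ^ 3 * u ^ 3)) * h4 +
    (-u ^ 4 * G + d * (u - τ * u ^ 2 + τ ^ 2 * u ^ 3)) * hτ

theorem dvd_det_add_smul_sub {R n : Type*} [CommRing R] [Fintype n] [DecidableEq n] (τ : R)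
    (X Y : Matrix n n R) : τ ∣ (X + τ • Y).det - X.det := by
  rw [← Ideal.mem_span_singleton, ← Ideal.Quotient.eq, RingHom.map_det, RingHom.map_det]
  congr 1
  ext i j
  exact Ideal.Quotient.eq.2 (by
    simpa using Ideal.mul_mem_right (Y i j) _ (Ideal.mem_span_singleton_self τ))

/-- The ring `ℂ[τ] / (τ ^ 4)`. -/
abbrev CubicJet : Type := Polynomial ℂ ⧸ Ideal.span {(Polynomial.X : Polynomial ℂ) ^ 4}

namespace CubicJet

/-- The nilpotent generator of `CubicJet`. -/
noncomputable def τ : CubicJet := Ideal.Quotient.mk _ Polynomial.X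

theorem tau_pow_four : τ ^ 4 = 0 := by
  rw [τ, ← map_pow]
  exact Ideal.Quotient.eq_zero_iff_mem.2 (Ideal.mem_span_singleton_self _)

theorem coeffs_eq_zero {c₀ c₁ c₂ c₃ : ℂ}
    (h : algebraMap ℂ CubicJet c₀ + algebraMap ℂ CubicJet c₁ * τ +
      algebraMap ℂ CubicJet c₂ * τ ^ 2 + algebraMap ℂ CubicJet c₃ * τ ^ 3 = 0) :
    c₀ = 0 ∧ c₁ = 0 ∧ c₂ = 0 ∧ c₃ = 0 := by
  have h1 : Ideal.Quotient.mk (Ideal.span {(Polynomial.X : Polynomial ℂ) ^ 4})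
    (Polynomial.C c₀ + Polynomial.C c₁ * Polynomial.X + Polynomial.C c₂ * Polynomial.X ^ 2 +
      Polynomial.C c₃ * Polynomial.X ^ 3) = 0 := by
    simp only [map_add, map_mul, map_pow]
    exact h
  rw [Ideal.Quotient.eq_zero_iff_mem, Ideal.mem_span_singleton, Polynomial.X_pow_dvd_iff] at h1
  have e0 := h1 0 (by norm_num)
  have e1 := h1 1 (by norm_num)
  have e2 := h1 2 (by norm_num)
  have e3 := h1 3 (by norm_num)
  simp [Polynomial.coeff_X, Polynomial.coeff_C, Polynomial.coeff_X_pow] at e0 e1 e2 e3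
  exact ⟨e0, e1, e2, e3⟩

/-- The block matrix `[[1 + τ D, τ B], [τ C, τ E]]` built from the blocks of a complex matrix. -/
noncomputable def pencil {m n : Type*} [DecidableEq m] (M : Matrix (m ⊕ n) (m ⊕ n) ℂ) :
    Matrix (m ⊕ n) (m ⊕ n) CubicJet :=
  fromBlocks (1 + τ • M.toBlocks₁₁.map (algebraMap ℂ CubicJet))
    (τ • M.toBlocks₁₂.map (algebraMap ℂ CubicJet)) (τ • M.toBlocks₂₁.map (algebraMap ℂ CubicJet))
    (τ • M.toBlocks₂₂.map (algebraMap ℂ CubicJet))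

section

variable {m : Type*} [Fintype m] [DecidableEq m] {d : ℂ}

theorem exists_eq_of_det_pencil {n : Type*} [Fintype n] [DecidableEq n]
    {M : Matrix (m ⊕ n) (m ⊕ n) ℂ} (h : (pencil M).det = algebraMap ℂ CubicJet d * τ ^ 3) :
    ∃ F : Matrix n n ℂ, algebraMap ℂ CubicJet d * τ ^ 3 = τ ^ Fintype.card n *
      (of fun i j => algebraMap ℂ CubicJet (M.toBlocks₂₂ i j) -
        τ * algebraMap ℂ CubicJet ((M.toBlocks₂₁ * M.toBlocks₁₂) i j) +
        τ ^ 2 * algebraMap ℂ CubicJet ((M.toBlocks₂₁ * M.toBlocks₁₁ * M.toBlocks₁₂) i j) -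
        τ ^ 3 * algebraMap ℂ CubicJet (F i j)).det := by
  refine ⟨M.toBlocks₂₁ * M.toBlocks₁₁ * M.toBlocks₁₁ * M.toBlocks₁₂, ?_⟩
  rw [det_fromBlocks_one_add_smul tau_pow_four _ _ _ _ h]
  simp only [← Matrix.map_mul]
  rfl

theorem lowest_coeff_of_card_zero {M : Matrix (m ⊕ Fin 0) (m ⊕ Fin 0) ℂ}
    (h : (pencil M).det = algebraMap ℂ CubicJet d * τ ^ 3) : False := by
  obtain ⟨F, hF⟩ := exists_eq_of_det_pencil h
  have := coeffs_eq_zero (c₀ := 1) (c₁ := 0) (c₂ := 0) (c₃ := -d) (by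
    simp only [Matrix.det_isEmpty, Fintype.card_fin, pow_zero, mul_one] at hF
    simp only [map_zero, map_one, map_neg]
    linear_combination -hF)
  exact one_ne_zero this.1

theorem lowest_coeff_of_card_one {M : Matrix (m ⊕ Fin 1) (m ⊕ Fin 1) ℂ}
    (h : (pencil M).det = algebraMap ℂ CubicJet d * τ ^ 3) :
    (M.toBlocks₂₁ * M.toBlocks₁₂) 0 0 = 0 ∧
      (M.toBlocks₂₁ * M.toBlocks₁₁ * M.toBlocks₁₂) 0 0 = d := by
  obtain ⟨F, hF⟩ := exists_eq_of_det_pencil h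
  rw [det_fin_one, of_apply, Fintype.card_fin] at hF
  generalize (M.toBlocks₂₁ * M.toBlocks₁₂) 0 0 = b at *
  generalize (M.toBlocks₂₁ * M.toBlocks₁₁ * M.toBlocks₁₂) 0 0 = c at *
  have := coeffs_eq_zero (c₀ := 0) (c₁ := M.toBlocks₂₂ 0 0) (c₂ := -b) (c₃ := c - d) (by
    simp only [map_zero, map_neg, map_sub]
    linear_combination (-1 : CubicJet) * hF + algebraMap ℂ CubicJet (F 0 0) * tau_pow_four)
  exact ⟨neg_eq_zero.1 this.2.2.1, sub_eq_zero.1 this.2.2.2⟩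

theorem lowest_coeff_of_card_two {M : Matrix (m ⊕ Fin 2) (m ⊕ Fin 2) ℂ}
    (h : (pencil M).det = algebraMap ℂ CubicJet d * τ ^ 3) :
    M.toBlocks₂₂ 0 0 * M.toBlocks₂₂ 1 1 - M.toBlocks₂₂ 0 1 * M.toBlocks₂₂ 1 0 = 0 ∧
      (M.toBlocks₂₂ = 0 → d = 0) := by
  obtain ⟨F, hF⟩ := exists_eq_of_det_pencil h
  rw [det_fin_two] at hF
  simp only [of_apply, Fintype.card_fin] at hF
  generalize M.toBlocks₂₁ * M.toBlocks₁₂ = b at *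
  generalize M.toBlocks₂₁ * M.toBlocks₁₁ * M.toBlocks₁₂ = c at *
  generalize M.toBlocks₂₂ = e at *
  have := coeffs_eq_zero (c₀ := 0) (c₁ := 0) (c₂ := e 0 0 * e 1 1 - e 0 1 * e 1 0)
    (c₃ := -(e 0 0 * b 1 1 + e 1 1 * b 0 0 - e 0 1 * b 1 0 - e 1 0 * b 0 1) - d) (by
    have h5 := tau_pow_four
    simp only [map_zero, map_neg, map_sub, map_add, map_mul]
    generalize algebraMap ℂ CubicJet = φ at *
    obtain ⟨g, hg⟩ : ∃ g : Fin 2 → Fin 2 → CubicJet, ∀ i j, g i j = φ (c i j) - τ * φ (F i j) :=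
      ⟨_, fun _ _ => rfl⟩
    have hm : ∀ i j, φ (e i j) - τ * φ (b i j) + τ ^ 2 * φ (c i j) - τ ^ 3 * φ (F i j) =
        φ (e i j) - τ * φ (b i j) + τ ^ 2 * g i j := fun i j => by rw [hg]; ring
    simp only [hm] at hF
    linear_combination -hF - (φ (e 0 0) * g 1 1 + φ (e 1 1) * g 0 0 + φ (b 0 0) * φ (b 1 1) -
      τ * (φ (b 0 0) * g 1 1 + g 0 0 * φ (b 1 1)) + τ ^ 2 * g 0 0 * g 1 1 -
      (φ (e 0 1) * g 1 0 + φ (e 1 0) * g 0 1 + φ (b 0 1) * φ (b 1 0) -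
      τ * (φ (b 0 1) * g 1 0 + g 0 1 * φ (b 1 0)) + τ ^ 2 * g 0 1 * g 1 0)) * h5)
  refine ⟨this.2.2.1, ?_⟩
  rintro rfl
  simpa using this.2.2.2

theorem lowest_coeff_of_card_three {M : Matrix (m ⊕ Fin 3) (m ⊕ Fin 3) ℂ}
    (h : (pencil M).det = algebraMap ℂ CubicJet d * τ ^ 3) : M.toBlocks₂₂.det = d := by
  obtain ⟨F, hF⟩ := exists_eq_of_det_pencil h
  let φ := algebraMap ℂ CubicJet
  obtain ⟨w, hw⟩ := dvd_det_add_smul_sub τ (M.toBlocks₂₂.map φ)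
    (-(M.toBlocks₂₁ * M.toBlocks₁₂).map φ +
      τ • (M.toBlocks₂₁ * M.toBlocks₁₁ * M.toBlocks₁₂).map φ - τ ^ 2 • F.map φ)
  have hm : (of fun i j => φ (M.toBlocks₂₂ i j) - τ * φ ((M.toBlocks₂₁ * M.toBlocks₁₂) i j) +
      τ ^ 2 * φ ((M.toBlocks₂₁ * M.toBlocks₁₁ * M.toBlocks₁₂) i j) - τ ^ 3 * φ (F i j)) =
      M.toBlocks₂₂.map φ + τ • (-(M.toBlocks₂₁ * M.toBlocks₁₂).map φ +
      τ • (M.toBlocks₂₁ * M.toBlocks₁₁ * M.toBlocks₁₂).map φ - τ ^ 2 • F.map φ) := by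
    ext i j
    simp only [of_apply, Matrix.add_apply, Matrix.sub_apply, Matrix.neg_apply, Matrix.smul_apply,
      map_apply, smul_eq_mul]
    ring
  rw [hm, Fintype.card_fin] at hF
  have hd : (M.toBlocks₂₂.map φ).det = φ M.toBlocks₂₂.det := (RingHom.map_det φ _).symm
  rw [hd] at hw
  have := coeffs_eq_zero (c₀ := 0) (c₁ := 0) (c₂ := 0) (c₃ := M.toBlocks₂₂.det - d) (by
    simp only [map_zero, map_sub]
    linear_combination -hF - τ ^ 3 * hw - w * tau_pow_four)
  exact sub_eq_zero.1 this.2.2.2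

theorem lowest_coeff_of_four_le_card {k : ℕ} (hk : 4 ≤ k) {M : Matrix (m ⊕ Fin k) (m ⊕ Fin k) ℂ}
    (h : (pencil M).det = algebraMap ℂ CubicJet d * τ ^ 3) : d = 0 := by
  obtain ⟨F, hF⟩ := exists_eq_of_det_pencil h
  rw [Fintype.card_fin, pow_eq_zero_of_le hk tau_pow_four, zero_mul] at hF
  exact (coeffs_eq_zero (c₀ := 0) (c₁ := 0) (c₂ := 0) (c₃ := d) (by simpa using hF)).2.2.2

end
end CubicJet

theorem CubicJet.pencil_eq {m n : Type*} [DecidableEq m] (M : Matrix (m ⊕ n) (m ⊕ n) ℂ) :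
    pencil M = fromBlocks 1 0 0 0 + τ • M.map (algebraMap ℂ CubicJet) := by
  ext (i | i) (j | j) <;> simp [pencil] <;> rfl

/-- The linear part of a matrix of polynomials, as a linear map. -/
noncomputable def linearPart {l m : Type*} [Fintype l]
    (A : Matrix m m (MvPolynomial (l × l) ℂ)) :
    Matrix l l ℂ →ₗ[ℂ] Matrix m m ℂ where
  toFun x := of fun p q => ∑ i : l × l, coeff (Finsupp.single i 1) (A p q) * x i.1 i.2
  map_add' x y := by ext; simp [mul_add, Finset.sum_add_distrib]
  map_smul' c x := by ext; simp [Finset.mul_sum, mul_left_comm]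

theorem map_mul_mul_submatrix_symm {R S m n k : Type*} [CommRing R] [CommRing S] [Fintype m]
    [DecidableEq n] (φ : R →+* S) (τ : S) (e : m ≃ n ⊕ k) {V U A₀ L : Matrix m m R}
    {A : Matrix m m S} (h : V * A₀ * U = (fromBlocks 1 0 0 0).submatrix e e)
    (hA : A = A₀.map φ + τ • L.map φ) :
    (V.map φ * A * U.map φ).submatrix e.symm e.symm =
      fromBlocks 1 0 0 0 + τ • ((V * L * U).submatrix e.symm e.symm).map φ := by
  have h1 : (V * A₀ * U).map φ = (fromBlocks 1 0 0 0).submatrix e e := by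
    rw [h, ← submatrix_map, fromBlocks_map]
    simp
  rw [hA, Matrix.mul_add, Matrix.add_mul, ← Matrix.map_mul, ← Matrix.map_mul, h1,
    Matrix.mul_smul, Matrix.smul_mul, ← Matrix.map_mul, ← Matrix.map_mul]
  simp only [submatrix_add, submatrix_smul, submatrix_submatrix, Equiv.self_comp_symm,
    submatrix_id_id, submatrix_map, Pi.add_apply, Pi.smul_apply]

theorem exists_det_pencil_eq {l s : ℕ} {A : Matrix (Fin s) (Fin s) (MvPolynomial (Fin l × Fin l) ℂ)}
    (hA : ∀ p q, (A p q).totalDegree ≤ 1) (hdet : A.det = permPoly l) :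
    ∃ (r k : ℕ) (M : Matrix (Fin l) (Fin l) ℂ →ₗ[ℂ] Matrix (Fin r ⊕ Fin k) (Fin r ⊕ Fin k) ℂ)
      (δ : ℂ), r + k = s ∧ δ ≠ 0 ∧ ∀ x, (CubicJet.pencil (M x)).det =
        algebraMap ℂ CubicJet (δ * x.permanent) * CubicJet.τ ^ l := by
  obtain ⟨V, U, e, hV, hU, heq⟩ := exists_rank_normal_form (A.map (coeff 0))
  refine ⟨_, _, (reindexLinearEquiv ℂ ℂ e e).toLinearMap.comp
    ((LinearMap.mulRight ℂ U).comp ((LinearMap.mulLeft ℂ V).comp (linearPart A))),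
    V.det * U.det, ?_, mul_ne_zero ?_ ?_, fun x => ?_⟩
  · have := Fintype.card_congr e
    simpa using this.symm
  · exact ((isUnit_iff_isUnit_det V).1 hV).ne_zero
  · exact ((isUnit_iff_isUnit_det U).1 hU).ne_zero
  let φ := algebraMap ℂ CubicJet
  let ev : MvPolynomial (Fin l × Fin l) ℂ →ₐ[ℂ] CubicJet :=
    aeval fun p => CubicJet.τ * φ (x p.1 p.2)
  have hev : A.map ev = (A.map (coeff 0)).map φ + CubicJet.τ • (linearPart A x).map φ := by
    ext p q
    exact aeval_mul_algebraMap_of_totalDegree_le_one CubicJet.τ (fun p : Fin l × Fin l => x p.1 p.2)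
      (hA p q)
  have hp := map_mul_mul_submatrix_symm φ CubicJet.τ e heq hev
  rw [← CubicJet.pencil_eq] at hp
  change (CubicJet.pencil (reindex e e (V * linearPart A x * U))).det = _
  have h1 : (A.map ev).det = CubicJet.τ ^ l * φ x.permanent := by
    rw [← aeval_permPoly, ← hdet]
    exact (AlgHom.map_det ev A).symm
  rw [reindex_apply, ← hp, det_submatrix_equiv_self, det_mul, det_mul, h1, map_mul, map_mul,
    RingHom.map_det, RingHom.map_det]
  simp only [RingHom.mapMatrix_apply]
  ring

section

variable {m : Type*} [Fintype m] [DecidableEq m] {δ : ℂ}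

theorem exists_det_pencil_ne_of_card_one (hm : Fintype.card m ≤ 5) (hδ : δ ≠ 0)
    (M : Matrix (Fin 3) (Fin 3) ℂ →ₗ[ℂ] Matrix (m ⊕ Fin 1) (m ⊕ Fin 1) ℂ) :
    ∃ x, (CubicJet.pencil (M x)).det ≠
      algebraMap ℂ CubicJet (δ * x.permanent) * CubicJet.τ ^ 3 := by
  by_contra! h
  have h1 := fun x => (CubicJet.lowest_coeff_of_card_one (h x)).1
  have h2 := fun x => (CubicJet.lowest_coeff_of_card_one (h x)).2
  let b : Matrix (Fin 3) (Fin 3) ℂ →ₗ[ℂ] (m → ℂ) :=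
    { toFun := fun x i => M x (.inl i) (.inr 0)
      map_add' := fun x y => by ext; simp
      map_smul' := fun t x => by ext; simp }
  let c : Matrix (Fin 3) (Fin 3) ℂ →ₗ[ℂ] (m → ℂ) :=
    { toFun := fun x i => M x (.inr 0) (.inl i)
      map_add' := fun x y => by ext; simp
      map_smul' := fun t x => by ext; simp }
  have hd : ∀ x, c x ⬝ᵥ (M x).toBlocks₁₁ *ᵥ b x = δ * x.permanent := fun x => by
    rw [← h2, Matrix.mul_assoc]
    rfl
  have h3 := finrank_le_of_dotProduct_eq_zero b c fun x => by
    rw [dotProduct_comm]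
    exact h1 x
  have h4 := finrank_le_three_of_permanents_eq_zero (LinearMap.ker (b.prod c)) fun x hx k l => by
    have hb : b x = 0 := congrArg Prod.fst hx
    have hc : c x = 0 := congrArg Prod.snd hx
    have hx0 : δ * x.permanent = 0 := by rw [← hd, hb, hc]; simp
    have ht : ∀ t : ℂ, t ^ 2 * (c (single k l 1) ⬝ᵥ (M x).toBlocks₁₁ *ᵥ b (single k l 1)) +
        t ^ 3 * (c (single k l 1) ⬝ᵥ (M (single k l 1)).toBlocks₁₁ *ᵥ b (single k l 1)) =
        δ * (t * (x (k + 1) (l + 1) * x (k + 2) (l + 2) +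
          x (k + 1) (l + 2) * x (k + 2) (l + 1))) := fun t => by
      have h5 := hd (x + t • single k l 1)
      have h6 : (M (x + t • single k l 1)).toBlocks₁₁ =
          (M x).toBlocks₁₁ + t • (M (single k l 1)).toBlocks₁₁ := by
        rw [map_add, map_smul]
        rfl
      rw [h6, map_add, map_add, hb, hc, zero_add, zero_add, map_smul, map_smul,
        permanent_add_smul_single, mul_add, hx0, zero_add] at h5
      rw [← h5]
      simp only [add_mulVec, mulVec_smul, smul_mulVec, dotProduct_add, dotProduct_smul,
        smul_dotProduct, smul_eq_mul]
      ring
    have e1 := ht 1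
    have e2 := ht (-1)
    have e3 := ht 2
    exact mul_left_cancel₀ hδ (by linear_combination -(6 * e1 - 2 * e2 - e3) / 6)
  simp [finrank_matrix] at h3
  omega

theorem exists_det_pencil_ne_of_card_two (hδ : δ ≠ 0)
    (M : Matrix (Fin 3) (Fin 3) ℂ →ₗ[ℂ] Matrix (m ⊕ Fin 2) (m ⊕ Fin 2) ℂ) :
    ∃ x, (CubicJet.pencil (M x)).det ≠
      algebraMap ℂ CubicJet (δ * x.permanent) * CubicJet.τ ^ 3 := by
  by_contra! h
  have h1 := fun x => (CubicJet.lowest_coeff_of_card_two (h x)).1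
  have h2 := fun x => (CubicJet.lowest_coeff_of_card_two (h x)).2
  let b : Matrix (Fin 3) (Fin 3) ℂ →ₗ[ℂ] (Fin 2 → ℂ) :=
    { toFun := fun x => ![M x (.inr 0) (.inr 0), M x (.inr 0) (.inr 1)]
      map_add' := fun x y => by simp
      map_smul' := fun t x => by simp }
  let c : Matrix (Fin 3) (Fin 3) ℂ →ₗ[ℂ] (Fin 2 → ℂ) :=
    { toFun := fun x => ![M x (.inr 1) (.inr 1), -M x (.inr 1) (.inr 0)]
      map_add' := fun x y => by simp [add_comm]
      map_smul' := fun t x => by simp }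
  have h3 := finrank_le_of_dotProduct_eq_zero b c fun x => by
    have := h1 x
    simp [b, c, toBlocks₂₂] at this ⊢
    linear_combination this
  have h4 := finrank_le_six_of_permanent_eq_zero (LinearMap.ker (b.prod c)) fun x hx => by
    have hb : b x = 0 := congrArg Prod.fst hx
    have hc : c x = 0 := congrArg Prod.snd hx
    refine (mul_eq_zero.1 (h2 x ?_)).resolve_left hδ
    ext i j
    fin_cases i <;> fin_cases j
    · exact congrFun hb 0
    · exact congrFun hb 1
    · exact neg_eq_zero.1 (congrFun hc 1)
    · exact congrFun hc 0
  simp [finrank_matrix] at h3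
  omega

theorem exists_det_pencil_ne_of_card_three (hδ : δ ≠ 0)
    (M : Matrix (Fin 3) (Fin 3) ℂ →ₗ[ℂ] Matrix (m ⊕ Fin 3) (m ⊕ Fin 3) ℂ) :
    ∃ x, (CubicJet.pencil (M x)).det ≠
      algebraMap ℂ CubicJet (δ * x.permanent) * CubicJet.τ ^ 3 := by
  by_contra! h
  exact permanent_ne_smul_det
    { toFun := fun x => (M x).toBlocks₂₂
      map_add' := fun x y => by rw [map_add]; rfl
      map_smul' := fun t x => by rw [map_smul]; rfl } hδ
    fun x => CubicJet.lowest_coeff_of_card_three (h x)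

end

theorem det_ne_permPoly_three {s : ℕ} (hs : s ≤ 6)
    {A : Matrix (Fin s) (Fin s) (MvPolynomial (Fin 3 × Fin 3) ℂ)}
    (hA : ∀ p q, (A p q).totalDegree ≤ 1) : A.det ≠ permPoly 3 := by
  intro hdet
  obtain ⟨r, k, M, δ, hrk, hδ, h⟩ := exists_det_pencil_eq hA hdet
  match k with
  | 0 => exact CubicJet.lowest_coeff_of_card_zero (h 0)
  | 1 =>
    obtain ⟨x, hx⟩ := exists_det_pencil_ne_of_card_one (by rw [Fintype.card_fin]; omega) hδ M
    exact hx (h x)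
  | 2 =>
    obtain ⟨x, hx⟩ := exists_det_pencil_ne_of_card_two hδ M
    exact hx (h x)
  | 3 =>
    obtain ⟨x, hx⟩ := exists_det_pencil_ne_of_card_three hδ M
    exact hx (h x)
  | k + 4 =>
    have := CubicJet.lowest_coeff_of_four_le_card (by omega) (h 1)
    rw [permanent_one, mul_one] at this
    exact hδ this

/-- **Optimality of `dc(3) = 7`**: for every `s ≤ 6` there is no `s × s` matrix of
affine-linear polynomials over ℂ in the nine variables `x_{ij}` (`1 ≤ i,j ≤ 3`) whose
determinant is `PER_3`; that is, the determinantal complexity of the `3 × 3` permanent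
over ℂ equals `7` (a `7 × 7` affine-linear determinantal representation does exist). -/
theorem dc_three_eq_seven :
    (∀ s ≤ 6, ∀ A : Matrix (Fin s) (Fin s) (MvPolynomial (Fin 3 × Fin 3) ℂ),
      (∀ p q, (A p q).totalDegree ≤ 1) → A.det ≠ permPoly 3) ∧
    (∃ A : Matrix (Fin 7) (Fin 7) (MvPolynomial (Fin 3 × Fin 3) ℂ),
      (∀ p q, (A p q).totalDegree ≤ 1) ∧ A.det = permPoly 3) := by
  exact ⟨fun s hs A hA => det_ne_permPoly_three hs hA,
    grenetMatrix, totalDegree_grenetMatrix, det_grenetMatrix⟩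
end

section
/- Marcus–Minc theorem: for every n ≥ 3 there is no n×n matrix [f_{pq}] whose entries f_{pq} are homogeneous linear forms over ℂ in the n² variables x_{ij} such that PER_n = det([f_{pq}]) as multivariate polynomials over ℂ. -/
open MvPolynomial

section

variable {n : ℕ}

/-- The generalized matrix function `∑_σ χ(σ) ∏_i M_{i,σ(i)}`; the permanent and the determinant
are the cases `χ = 1` and `χ = sign`. -/
noncomputable def generalizedMatrixFunction (χ : Equiv.Perm (Fin n) → ℂ)
    (M : Matrix (Fin n) (Fin n) ℂ) : ℂ :=
  ∑ σ, χ σ * ∏ i, M i (σ i)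

/-- The second difference of `g` in the direction `M` vanishes at every point. -/
def SecondDifferenceVanishes (g : Matrix (Fin n) (Fin n) ℂ → ℂ) (M : Matrix (Fin n) (Fin n) ℂ) :
    Prop :=
  ∀ Z, g (Z + M) + g (Z - M) = 2 * g Z

theorem generalizedMatrixFunction_sign (M : Matrix (Fin n) (Fin n) ℂ) :
    generalizedMatrixFunction (fun σ => ((Equiv.Perm.sign σ : ℤ) : ℂ)) M = M.det := by
  rw [← Matrix.det_transpose, Matrix.det_apply']
  simp [generalizedMatrixFunction]

theorem generalizedMatrixFunction_eq_zero_of_row_eq_zero (χ : Equiv.Perm (Fin n) → ℂ)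
    {M : Matrix (Fin n) (Fin n) ℂ} {i : Fin n} (h : ∀ j, M i j = 0) :
    generalizedMatrixFunction χ M = 0 :=
  Finset.sum_eq_zero fun σ _ => by
    rw [Finset.prod_eq_zero (f := fun k => M k (σ k)) (Finset.mem_univ i) (h _), mul_zero]

theorem Equiv.Perm.eq_or_eq_mul_swap {α : Type*} [DecidableEq α] {σ τ : Equiv.Perm α} {i i' : α}
    (h : ∀ k, k ≠ i → k ≠ i' → τ k = σ k) : τ = σ ∨ τ = σ * Equiv.swap i i' := by
  have hinv : ∀ k, k = i ∨ k = i' → τ k = σ i ∨ τ k = σ i' := by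
    intro k hk
    by_contra! hne
    have h1 : σ (σ.symm (τ k)) = τ k := σ.apply_symm_apply _
    have h2 : σ.symm (τ k) ≠ i := fun e => hne.1 (by rw [← h1, e])
    have h3 : σ.symm (τ k) ≠ i' := fun e => hne.2 (by rw [← h1, e])
    have h4 := τ.injective ((h _ h2 h3).trans h1)
    rcases hk with rfl | rfl
    · exact h2 h4
    · exact h3 h4
  by_cases hii : i = i'
  · subst hii
    left
    ext k
    by_cases hk : k = i
    · subst hk; simpa using hinv k (Or.inl rfl)
    · exact h k hk hk
  have hne : τ i ≠ τ i' := fun e => hii (τ.injective e)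
  rcases hinv i (Or.inl rfl) with h1 | h1 <;> rcases hinv i' (Or.inr rfl) with h2 | h2
  · exact absurd (h1.trans h2.symm) hne
  · left
    ext k
    by_cases hk : k = i
    · rw [hk, h1]
    by_cases hk' : k = i'
    · rw [hk', h2]
    exact h k hk hk'
  · right
    ext k
    by_cases hk : k = i
    · simp [hk, h1]
    by_cases hk' : k = i'
    · simp [hk', h2]
    rw [h k hk hk', Equiv.Perm.mul_apply, Equiv.swap_apply_of_ne_of_ne hk hk']
  · exact absurd (h1.trans h2.symm) hne

theorem Equiv.Perm.exists_apply_eq_apply_eq {α : Type*} [DecidableEq α] {i i' j j' : α}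
    (hi : i ≠ i') (hj : j ≠ j') : ∃ σ : Equiv.Perm α, σ i = j ∧ σ i' = j' := by
  refine ⟨Equiv.swap (Equiv.swap i j i') j' * Equiv.swap i j, ?_, by simp⟩
  rw [Equiv.Perm.mul_apply, Equiv.swap_apply_left]
  refine Equiv.swap_apply_of_ne_of_ne (fun e => hi ?_) hj
  apply (Equiv.swap i j).injective
  rw [← e, Equiv.swap_apply_left]

theorem prod_eq_mul_of_eq_one {i i' : Fin n} (hi : i ≠ i') {g : Fin n → ℂ}
    (h : ∀ k, k ≠ i → k ≠ i' → g k = 1) : ∏ k, g k = g i * g i' := by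
  rw [← Finset.prod_pair hi]
  refine (Finset.prod_subset (Finset.subset_univ _) fun k _ hk => ?_).symm
  simp only [Finset.mem_insert, Finset.mem_singleton, not_or] at hk
  exact h k hk.1 hk.2

theorem generalizedMatrixFunction_of_rows_eq_single (χ : Equiv.Perm (Fin n) → ℂ)
    (σ : Equiv.Perm (Fin n)) {i i' : Fin n} (hi : i ≠ i') {M : Matrix (Fin n) (Fin n) ℂ}
    (h : ∀ k, k ≠ i → k ≠ i' → ∀ l, M k l = if l = σ k then 1 else 0) :
    generalizedMatrixFunction χ M = χ σ * (M i (σ i) * M i' (σ i')) +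
      χ (σ * Equiv.swap i i') * (M i (σ i') * M i' (σ i)) := by
  have hne : σ ≠ σ * Equiv.swap i i' := fun e => hi <| σ.injective <| by
    have := congrArg (fun τ : Equiv.Perm (Fin n) => τ i) e
    simpa using this
  have hsum : ∑ τ ∈ ({σ, σ * Equiv.swap i i'} : Finset (Equiv.Perm (Fin n))),
      χ τ * ∏ k, M k (τ k) = generalizedMatrixFunction χ M := by
    refine Finset.sum_subset (Finset.subset_univ _) fun τ _ hτ => ?_
    simp only [Finset.mem_insert, Finset.mem_singleton] at hτ
    have : ∃ k, k ≠ i ∧ k ≠ i' ∧ τ k ≠ σ k := by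
      by_contra! hc
      exact hτ (Equiv.Perm.eq_or_eq_mul_swap hc)
    obtain ⟨k, hk, hk', hkτ⟩ := this
    rw [Finset.prod_eq_zero (Finset.mem_univ k) (by rw [h k hk hk', if_neg hkτ]), mul_zero]
  rw [← hsum, Finset.sum_pair hne, prod_eq_mul_of_eq_one hi, prod_eq_mul_of_eq_one hi]
  · simp
  · intro k hk hk'
    rw [h k hk hk', if_pos]
    rw [Equiv.Perm.mul_apply, Equiv.swap_apply_of_ne_of_ne hk hk']
  · intro k hk hk'
    rw [h k hk hk', if_pos rfl]

theorem SecondDifferenceVanishes.two_by_two {χ : Equiv.Perm (Fin n) → ℂ}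
    {M : Matrix (Fin n) (Fin n) ℂ}
    (hM : SecondDifferenceVanishes (generalizedMatrixFunction χ) M) (σ : Equiv.Perm (Fin n))
    {i i' : Fin n} (hi : i ≠ i') :
    χ σ * (M i (σ i) * M i' (σ i')) + χ (σ * Equiv.swap i i') * (M i (σ i') * M i' (σ i)) = 0 := by
  let Z : Matrix (Fin n) (Fin n) ℂ := Matrix.of fun k l =>
    if k = i then M i l else if k = i' then 0 else (if l = σ k then 1 else 0) - M k l
  have h0 : generalizedMatrixFunction χ Z = 0 :=
    generalizedMatrixFunction_eq_zero_of_row_eq_zero χ (i := i') fun j => by simp [Z, hi.symm]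
  have h1 : generalizedMatrixFunction χ (Z - M) = 0 :=
    generalizedMatrixFunction_eq_zero_of_row_eq_zero χ (i := i) fun j => by simp [Z]
  have h2 := hM Z
  rw [h0, h1, generalizedMatrixFunction_of_rows_eq_single χ σ hi] at h2
  · simp only [Matrix.add_apply, Z, Matrix.of_apply, hi.symm, if_true, if_false] at h2
    linear_combination h2 / 2
  · intro k hk hk' l
    simp [Z, hk, hk']

theorem Matrix.exists_eq_vecMulVec_of_secondDifferenceVanishes_det {M : Matrix (Fin n) (Fin n) ℂ}
    (hM : SecondDifferenceVanishes Matrix.det M) : ∃ u v, M = Matrix.vecMulVec u v := by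
  have hM' : SecondDifferenceVanishes
      (generalizedMatrixFunction fun σ => ((Equiv.Perm.sign σ : ℤ) : ℂ)) M := by
    intro Z
    simpa only [generalizedMatrixFunction_sign] using hM Z
  have key : ∀ i i' j j', M i j * M i' j' = M i j' * M i' j := by
    intro i i' j j'
    by_cases hi : i = i'
    · subst hi; ring
    by_cases hj : j = j'
    · subst hj; ring
    obtain ⟨σ, rfl, rfl⟩ := Equiv.Perm.exists_apply_eq_apply_eq hi hj
    have h := hM'.two_by_two σ hi
    simp only [Equiv.Perm.sign_mul, Equiv.Perm.sign_swap hi] at h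
    have hs : (((Equiv.Perm.sign σ : ℤˣ) : ℤ) : ℂ) ≠ 0 := by
      rcases Int.units_eq_one_or (Equiv.Perm.sign σ) with e | e <;> simp [e]
    push_cast at h
    apply mul_left_cancel₀ hs
    linear_combination h
  by_cases h0 : M = 0
  · exact ⟨0, 0, by simp [h0]⟩
  obtain ⟨i, j, hij⟩ : ∃ i j, M i j ≠ 0 := by
    by_contra! hc
    exact h0 (Matrix.ext hc)
  refine ⟨fun k => M k j, fun l => M i l / M i j, ?_⟩
  ext k l
  rw [Matrix.vecMulVec_apply]
  field_simp
  linear_combination key k i l j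

theorem secondDifferenceVanishes_det_vecMulVec (u v : Fin n → ℂ) :
    SecondDifferenceVanishes Matrix.det (Matrix.vecMulVec u v) := by
  intro W
  let B : (Fin n → ℂ) → Matrix (Unit ⊕ Fin n) (Unit ⊕ Fin n) ℂ := fun w =>
    Matrix.fromBlocks 1 (Matrix.replicateRow Unit w) (Matrix.replicateCol Unit u) W
  have hB : ∀ w, (B w).det = (W - Matrix.vecMulVec u w).det := fun w => by
    rw [Matrix.det_fromBlocks_one₁₁, Matrix.vecMulVec_eq Unit]
  have hrow : ∀ w, B w = (B 0).updateRow (Sum.inl ()) (Sum.elim (fun _ => 1) w) := fun w => by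
    ext a b
    rcases a with a | a <;> rcases b with b | b <;> simp [B, Matrix.updateRow_apply]
  have hadd : (B (-v)).det + (B v).det = 2 * (B 0).det := by
    rw [hrow (-v), hrow v, ← Matrix.det_updateRow_add]
    conv_rhs => rw [hrow 0, ← Matrix.det_updateRow_smul]
    congr 2
    ext b
    rcases b with b | b <;> simp
    norm_num
  simp only [hB, Matrix.vecMulVec_neg, Matrix.vecMulVec_zero, sub_neg_eq_add, sub_zero] at hadd
  exact hadd

/-- The `2 × 2` block with rows `(1, 1)` and `(1, -1)`, placed at the rows and columns `p, q`. -/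
def signedBlock (p q : Fin n) : Matrix (Fin n) (Fin n) ℂ := fun i j =>
  if i = p ∧ (j = p ∨ j = q) then 1
  else if i = q ∧ j = p then 1
  else if i = q ∧ j = q then -1
  else 0

theorem secondDifferenceVanishes_signedBlock {p q : Fin n} (hpq : p ≠ q) :
    SecondDifferenceVanishes (generalizedMatrixFunction fun _ => 1) (signedBlock p q) := by
  intro Z
  set A := signedBlock p q with hA
  have hA0 : ∀ k, k ≠ p → k ≠ q → ∀ l, A k l = 0 := fun k hp hq l => by
    simp [hA, signedBlock, hp, hq]
  have hsplit : ∀ g : Fin n → ℂ,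
      ∏ k, g k = g p * g q * ∏ k ∈ (Finset.univ.erase p).erase q, g k := fun g => by
    rw [← Finset.mul_prod_erase _ _ (Finset.mem_univ p),
      ← Finset.mul_prod_erase _ _ (Finset.mem_erase.2 ⟨hpq.symm, Finset.mem_univ q⟩), mul_assoc]
  let R : Equiv.Perm (Fin n) → ℂ := fun σ => ∏ k ∈ (Finset.univ.erase p).erase q, Z k (σ k)
  have hR : ∀ (N : Matrix (Fin n) (Fin n) ℂ) (σ : Equiv.Perm (Fin n)),
      (∀ k, k ≠ p → k ≠ q → ∀ l, N k l = Z k l) →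
      ∏ k, N k (σ k) = N p (σ p) * N q (σ q) * R σ := fun N σ h => by
    rw [hsplit]
    congr 1
    refine Finset.prod_congr rfl fun k hk => ?_
    simp only [Finset.mem_erase] at hk
    exact h k hk.2.1 hk.1 _
  have hterm : ∀ σ : Equiv.Perm (Fin n),
      ∏ k, (Z + A) k (σ k) + ∏ k, (Z - A) k (σ k) - 2 * ∏ k, Z k (σ k) =
        2 * (A p (σ p) * A q (σ q) * R σ) := fun σ => by
    rw [hR (Z + A) σ fun k hp hq l => by simp [hA0 k hp hq l],
      hR (Z - A) σ fun k hp hq l => by simp [hA0 k hp hq l], hR Z σ fun _ _ _ _ => rfl]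
    simp only [Matrix.add_apply, Matrix.sub_apply]
    ring
  have hzero : ∑ σ : Equiv.Perm (Fin n), A p (σ p) * A q (σ q) * R σ = 0 := by
    refine Finset.sum_involution (fun σ _ => σ * Equiv.swap p q) ?_ ?_
      (fun _ _ => Finset.mem_univ _) (fun σ _ => by simp [mul_assoc])
    · intro σ _
      have hRs : R (σ * Equiv.swap p q) = R σ := Finset.prod_congr rfl fun k hk => by
        simp only [Finset.mem_erase] at hk
        rw [Equiv.Perm.mul_apply, Equiv.swap_apply_of_ne_of_ne hk.2.1 hk.1]
      have hσ : σ p ≠ σ q := fun e => hpq (σ.injective e)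
      have : A p (σ p) * A q (σ q) + A p (σ q) * A q (σ p) = 0 := by
        simp only [hA, signedBlock]
        grind
      simp only [hRs, Equiv.Perm.mul_apply, Equiv.swap_apply_left, Equiv.swap_apply_right]
      linear_combination R σ * this
    · intro σ _ _ e
      have := congrArg (fun τ : Equiv.Perm (Fin n) => τ p) e
      simp only [Equiv.Perm.mul_apply, Equiv.swap_apply_left] at this
      exact hpq (σ.injective this.symm)
  rw [← sub_eq_zero]
  simp only [generalizedMatrixFunction, one_mul, Finset.mul_sum, ← Finset.sum_add_distrib,
    ← Finset.sum_sub_distrib, hterm]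
  rw [← Finset.mul_sum, hzero, mul_zero]

/-- The polarization of the `2 × 2` permanent with rows `i, i'` and columns `j, j'`. -/
def mixedPermanent (A B : Matrix (Fin n) (Fin n) ℂ) (i i' j j' : Fin n) : ℂ :=
  A i j * B i' j' + A i' j' * B i j + A i j' * B i' j + A i' j * B i j'

theorem SecondDifferenceVanishes.permanent_two_by_two {M : Matrix (Fin n) (Fin n) ℂ}
    (hM : SecondDifferenceVanishes (generalizedMatrixFunction fun _ => 1) M) {i i' j j' : Fin n}
    (hi : i ≠ i') (hj : j ≠ j') : M i j * M i' j' + M i j' * M i' j = 0 := by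
  obtain ⟨σ, rfl, rfl⟩ := Equiv.Perm.exists_apply_eq_apply_eq hi hj
  simpa using hM.two_by_two σ hi

theorem mixedPermanent_eq_zero {A B : Matrix (Fin n) (Fin n) ℂ}
    (hA : SecondDifferenceVanishes (generalizedMatrixFunction fun _ => 1) A)
    (hB : SecondDifferenceVanishes (generalizedMatrixFunction fun _ => 1) B)
    (hAB : SecondDifferenceVanishes (generalizedMatrixFunction fun _ => 1) (A + B))
    {i i' j j' : Fin n} (hi : i ≠ i') (hj : j ≠ j') : mixedPermanent A B i i' j j' = 0 := by
  have h1 := hA.permanent_two_by_two hi hj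
  have h2 := hB.permanent_two_by_two hi hj
  have h3 := hAB.permanent_two_by_two hi hj
  simp only [Matrix.add_apply] at h3
  unfold mixedPermanent
  linear_combination h3 - h1 - h2

theorem eq_zero_of_mixedPermanent_signedBlock {p q : Fin n} (hpq : p ≠ q)
    {B : Matrix (Fin n) (Fin n) ℂ}
    (h : ∀ i i' j j', i ≠ i' → j ≠ j' → mixedPermanent (signedBlock p q) B i i' j j' = 0)
    (hpp : B p p = 0) (hpq' : B p q = 0) (hqp : B q p = 0) (hqq : B q q = 0) : B = 0 := by
  have hrow : ∀ i, i ≠ p → i ≠ q → B i p = 0 ∧ B i q = 0 := by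
    intro i hp hq
    have h1 := h p i p q hp.symm hpq
    have h2 := h q i p q hq.symm hpq
    simp [mixedPermanent, signedBlock, hp, hq, hpq, hpq.symm] at h1 h2
    constructor
    · linear_combination (h1 - h2) / 2
    · linear_combination (h1 + h2) / 2
  have hcol : ∀ j, j ≠ p → j ≠ q → B p j = 0 ∧ B q j = 0 := by
    intro j hp hq
    have h1 := h p q p j hpq hp.symm
    have h2 := h p q q j hpq hq.symm
    simp [mixedPermanent, signedBlock, hp, hq, hpq, hpq.symm] at h1 h2
    constructor
    · linear_combination (h1 - h2) / 2
    · linear_combination (h1 + h2) / 2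
  have hout : ∀ i j, i ≠ p → i ≠ q → j ≠ p → j ≠ q → B i j = 0 := by
    intro i j hip hiq hjp hjq
    have h1 := h p i p j hip.symm hjp.symm
    simpa [mixedPermanent, signedBlock, hip, hiq, hjp, hjq, hpq, hpq.symm] using h1
  ext i j
  rw [Matrix.zero_apply]
  grind

/-- For `n ≥ 3`, no linear endomorphism of the space of matrices turns the determinant into the
permanent. -/
theorem not_det_linearMap_eq_permanent (hn : 3 ≤ n)
    (F : Matrix (Fin n) (Fin n) ℂ →ₗ[ℂ] Matrix (Fin n) (Fin n) ℂ)
    (hF : ∀ X, (F X).det = generalizedMatrixFunction (fun _ => 1) X) : False := by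
  obtain ⟨p, q, hpq⟩ : ∃ p q : Fin n, p ≠ q := ⟨⟨0, by omega⟩, ⟨1, by omega⟩, by simp⟩
  have : Nontrivial (Fin n) := ⟨p, q, hpq⟩
  have hinj : Function.Injective F := by
    rw [← LinearMap.ker_eq_bot, LinearMap.ker_eq_bot']
    intro A hA
    ext i j
    obtain ⟨i', hi⟩ := exists_ne i
    obtain ⟨j', hj⟩ := exists_ne j
    obtain ⟨σ, hσ, -⟩ := Equiv.Perm.exists_apply_eq_apply_eq hi.symm hj.symm
    let Z : Matrix (Fin n) (Fin n) ℂ := Matrix.of fun k l =>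
      if k = i then 0 else (if l = σ k then 1 else 0) - A k l
    have h0 : generalizedMatrixFunction (fun _ => 1) Z = 0 :=
      generalizedMatrixFunction_eq_zero_of_row_eq_zero _ (i := i) fun j => by simp [Z]
    have h1 : generalizedMatrixFunction (fun _ => 1) (Z + A) = 0 := by
      rw [← hF, map_add, hA, add_zero, hF, h0]
    rw [generalizedMatrixFunction_of_rows_eq_single _ σ hi.symm] at h1
    · have hσi : σ i ≠ σ i' := fun e => hi (σ.injective e).symm
      simpa [Z, hi, hσ ▸ hσi, hσ] using h1
    · intro k hk _ l
      simp [Z, hk]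
  have hsurj : Function.Surjective F := LinearMap.injective_iff_surjective.1 hinj
  have hiff : ∀ X, SecondDifferenceVanishes Matrix.det (F X) ↔
      SecondDifferenceVanishes (generalizedMatrixFunction fun _ => 1) X := by
    intro X
    unfold SecondDifferenceVanishes
    rw [hsurj.forall]
    simp only [← map_add, ← map_sub, hF]
  set A := signedBlock p q with hA
  have hAper : SecondDifferenceVanishes (generalizedMatrixFunction fun _ => 1) A :=
    secondDifferenceVanishes_signedBlock hpq
  obtain ⟨u, v, huv⟩ :=
    Matrix.exists_eq_vecMulVec_of_secondDifferenceVanishes_det ((hiff A).2 hAper)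
  have hA0 : F A ≠ 0 := by
    rw [Ne, map_eq_zero_iff F hinj]
    intro h
    have : A p p = 0 := by rw [h]; rfl
    simp [hA, signedBlock] at this
  obtain ⟨i₀, hu⟩ : ∃ i, u i ≠ 0 := by
    by_contra! hc
    exact hA0 (by ext; simp [huv, Matrix.vecMulVec_apply, hc])
  obtain ⟨j₀, hv⟩ : ∃ j, v j ≠ 0 := by
    by_contra! hc
    exact hA0 (by ext; simp [huv, Matrix.vecMulVec_apply, hc])
  let e := LinearEquiv.ofBijective F ⟨hinj, hsurj⟩
  have he : ∀ X, F (e.symm X) = X := e.apply_symm_apply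
  have hrank : ∀ a b, SecondDifferenceVanishes (generalizedMatrixFunction fun _ => 1)
      (e.symm (Matrix.vecMulVec a b)) := fun a b => by
    rw [← hiff, he]
    exact secondDifferenceVanishes_det_vecMulVec a b
  have hAe : A = e.symm (Matrix.vecMulVec u v) := by rw [← huv]; exact (e.symm_apply_apply A).symm
  have hmix : ∀ x y i i' j j', i ≠ i' → j ≠ j' →
      mixedPermanent A (e.symm (Matrix.vecMulVec x v + Matrix.vecMulVec u y)) i i' j j' = 0 := by
    intro x y i i' j j' hi hj
    have h1 : mixedPermanent A (e.symm (Matrix.vecMulVec x v)) i i' j j' = 0 := by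
      refine mixedPermanent_eq_zero hAper (hrank _ _) ?_ hi hj
      rw [hAe, ← map_add, ← Matrix.add_vecMulVec]
      exact hrank _ _
    have h2 : mixedPermanent A (e.symm (Matrix.vecMulVec u y)) i i' j j' = 0 := by
      refine mixedPermanent_eq_zero hAper (hrank _ _) ?_ hi hj
      rw [hAe, ← map_add, ← Matrix.vecMulVec_add]
      exact hrank _ _
    rw [map_add]
    simp only [mixedPermanent, Matrix.add_apply] at h1 h2 ⊢
    linear_combination h1 + h2
  let T : (Fin n → ℂ) × (Fin n → ℂ) →ₗ[ℂ] Matrix (Fin n) (Fin n) ℂ :=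
    { toFun := fun z => e.symm (Matrix.vecMulVec z.1 v + Matrix.vecMulVec u z.2)
      map_add' := fun z w => by
        rw [← map_add]
        congr 1
        simp only [Prod.fst_add, Prod.snd_add, Matrix.add_vecMulVec, Matrix.vecMulVec_add]
        abel
      map_smul' := fun c z => by
        rw [RingHom.id_apply, ← map_smul]
        congr 1
        simp only [Prod.smul_fst, Prod.smul_snd, Matrix.smul_vecMulVec, Matrix.vecMulVec_smul,
          smul_add] }
  let L : (Fin n → ℂ) × (Fin n → ℂ) →ₗ[ℂ] (Fin 5 → ℂ) :=
    { toFun := fun z => ![T z p p, T z p q, T z q p, T z q q, z.2 j₀]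
      map_add' := fun z w => by simp
      map_smul' := fun c z => by simp }
  have hL : Function.Injective L := by
    rw [← LinearMap.ker_eq_bot, LinearMap.ker_eq_bot']
    rintro ⟨x, y⟩ hxy
    have hcoord := fun k => congrFun hxy k
    have hT : T (x, y) = 0 := eq_zero_of_mixedPermanent_signedBlock hpq (hmix x y)
      (hcoord 0) (hcoord 1) (hcoord 2) (hcoord 3)
    have hy₀ : y j₀ = 0 := hcoord 4
    have hsum : Matrix.vecMulVec x v + Matrix.vecMulVec u y = 0 :=
      (map_eq_zero_iff e.symm e.symm.injective).1 hT
    have hent : ∀ i j, x i * v j + u i * y j = 0 := fun i j => congrFun (congrFun hsum i) j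
    have hx : ∀ i, x i = 0 := fun i => by
      simpa [hy₀, hv] using hent i j₀
    have hy : ∀ j, y j = 0 := fun j => by
      simpa [hx, hu] using hent i₀ j
    exact Prod.ext (funext hx) (funext hy)
  have := LinearMap.finrank_le_finrank_of_injective hL
  simp at this
  omega

end

theorem MvPolynomial.IsHomogeneous.eval_add_of_one {σ R : Type*} [CommSemiring R]
    {f : MvPolynomial σ R} (hf : f.IsHomogeneous 1) (x y : σ → R) :
    eval (x + y) f = eval x f + eval y f := by
  have hf' : f ∈ Submodule.span R (Set.range X) := by
    rw [← homogeneousSubmodule_one_eq_span_X]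
    exact hf
  clear hf
  induction hf' using Submodule.span_induction with
  | mem g hg => obtain ⟨i, rfl⟩ := hg; simp
  | zero => simp
  | add g h _ _ hg hh => simp only [map_add, hg, hh]; ring
  | smul a g _ hg => simp only [smul_eval, hg]; ring

theorem MvPolynomial.IsHomogeneous.eval_smul_of_one {σ R : Type*} [CommSemiring R]
    {f : MvPolynomial σ R} (hf : f.IsHomogeneous 1) (c : R) (x : σ → R) :
    eval (c • x) f = c * eval x f := by
  have hf' : f ∈ Submodule.span R (Set.range X) := by
    rw [← homogeneousSubmodule_one_eq_span_X]
    exact hf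
  clear hf
  induction hf' using Submodule.span_induction with
  | mem g hg => obtain ⟨i, rfl⟩ := hg; simp
  | zero => simp
  | add g h _ _ hg hh => simp only [map_add, hg, hh]; ring
  | smul a g _ hg => simp only [smul_eval, hg]; ring

/-- Evaluation of a matrix of linear forms in the entries of a matrix, as a linear map. -/
noncomputable def evalLinearForms {n : ℕ}
    (f : Matrix (Fin n) (Fin n) (MvPolynomial (Fin n × Fin n) ℂ))
    (hf : ∀ p q, (f p q).IsHomogeneous 1) :
    Matrix (Fin n) (Fin n) ℂ →ₗ[ℂ] Matrix (Fin n) (Fin n) ℂ where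
  toFun Y := f.map (eval fun ij => Y ij.1 ij.2)
  map_add' Y W := Matrix.ext fun p q => by
    rw [Matrix.add_apply, Matrix.map_apply, Matrix.map_apply, Matrix.map_apply]
    exact (hf p q).eval_add_of_one (fun ij => Y ij.1 ij.2) (fun ij => W ij.1 ij.2)
  map_smul' c Y := Matrix.ext fun p q => by
    rw [RingHom.id_apply, Matrix.smul_apply, Matrix.map_apply, Matrix.map_apply, smul_eq_mul]
    exact (hf p q).eval_smul_of_one c (fun ij => Y ij.1 ij.2)

theorem det_evalLinearForms {n : ℕ}
    (f : Matrix (Fin n) (Fin n) (MvPolynomial (Fin n × Fin n) ℂ))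
    (hf : ∀ p q, (f p q).IsHomogeneous 1) (Y : Matrix (Fin n) (Fin n) ℂ) :
    (evalLinearForms f hf Y).det = eval (fun ij => Y ij.1 ij.2) f.det :=
  ((eval fun ij : Fin n × Fin n => Y ij.1 ij.2).map_det f).symm

theorem eval_permPoly {n : ℕ} (Y : Matrix (Fin n) (Fin n) ℂ) :
    eval (fun ij => Y ij.1 ij.2) (permPoly n) = generalizedMatrixFunction (fun _ => 1) Y := by
  simp [permPoly, generalizedMatrixFunction]

/-- **Marcus–Minc theorem**: for `n ≥ 3` there is no `n × n` matrix `[f_{pq}]` of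
homogeneous linear forms over ℂ in the variables `x_{ij}` with `PER_n = det [f_{pq}]`. -/
theorem marcus_minc (n : ℕ) (hn : 3 ≤ n) :
    ¬ ∃ f : Matrix (Fin n) (Fin n) (MvPolynomial (Fin n × Fin n) ℂ),
      (∀ p q, (f p q).IsHomogeneous 1) ∧ permPoly n = f.det := by
  rintro ⟨f, hf, hdet⟩
  refine not_det_linearMap_eq_permanent hn (evalLinearForms f hf) fun Y => ?_
  rw [det_evalLinearForms, ← hdet, eval_permPoly]
end

section
/- Frobenius' theorem on the symmetries of the determinant: let n ≥ 1 and let g be a ℂ-linear automorphism of the space of n×n complex matrices such that det(g(X)) = det(X) for every matrix X. Then there exist matrices A, B ∈ SL_n(ℂ) (i.e. with det A = 1 and det B = 1) such that either g(X) = A·X·B for all X, or g(X) = A·Xᵀ·B for all X. -/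
open Matrix

namespace Matrix

variable {n : Type*} [Fintype n] [DecidableEq n]

/-- The trace is determined by the function `t ↦ det (1 + t • M)`. -/
theorem trace_eq_of_det_one_add_smul_eq {M N : Matrix n n ℂ}
    (h : ∀ t : ℂ, (1 + t • M).det = (1 + t • N).det) : M.trace = N.trace := by
  have eval_det (A : Matrix n n ℂ) (t : ℂ) :
      (det (1 + (Polynomial.X : Polynomial ℂ) • A.map Polynomial.C)).eval t =
        (1 + t • A).det := by
    rw [← Polynomial.coe_evalRingHom, RingHom.map_det]
    congr 1
    ext i j
    simp [Matrix.one_apply, apply_ite, mul_comm (A i j)]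
  have hP : det (1 + (Polynomial.X : Polynomial ℂ) • M.map Polynomial.C) =
      det (1 + (Polynomial.X : Polynomial ℂ) • N.map Polynomial.C) :=
    Polynomial.funext fun t => by rw [eval_det, eval_det, h]
  rw [← derivative_det_one_add_X_smul, ← derivative_det_one_add_X_smul, hP]

theorem trace_sq_eq_of_det_one_add_smul_eq {M N : Matrix n n ℂ}
    (h : ∀ t : ℂ, (1 + t • M).det = (1 + t • N).det) :
    (M * M).trace = (N * N).trace := by
  refine trace_eq_of_det_one_add_smul_eq fun t => ?_
  obtain ⟨s, hs⟩ := IsAlgClosed.exists_pow_nat_eq (-t) two_pos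
  obtain rfl : t = -s ^ 2 := by rw [hs, neg_neg]
  have factor (A : Matrix n n ℂ) :
      1 + (-s ^ 2) • (A * A) = (1 + s • A) * (1 + (-s) • A) := by
    simp only [mul_add, add_mul, one_mul, mul_one, smul_mul_smul_comm]
    module
  simp only [factor, det_mul, h]

theorem trace_cube_eq_of_det_one_add_smul_eq {M N : Matrix n n ℂ}
    (h : ∀ t : ℂ, (1 + t • M).det = (1 + t • N).det) :
    (M * M * M).trace = (N * N * N).trace := by
  refine trace_eq_of_det_one_add_smul_eq fun t => ?_
  obtain ⟨s, rfl⟩ := IsAlgClosed.exists_pow_nat_eq t three_pos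
  obtain ⟨w, hw⟩ : ∃ w : ℂ, w ^ 2 + w + 1 = 0 := by
    obtain ⟨d, hd⟩ := IsAlgClosed.exists_pow_nat_eq (-3 : ℂ) two_pos
    exact ⟨(d - 1) / 2, by linear_combination hd / 4⟩
  have hw3 : w ^ 3 = 1 := by linear_combination (w - 1) * hw
  have factor (A : Matrix n n ℂ) :
      1 + s ^ 3 • (A * A * A) =
        (1 + s • A) * (1 + (w * s) • A) * (1 + (w ^ 2 * s) • A) := by
    simp only [mul_add, add_mul, one_mul, mul_one, smul_mul_smul_comm]
    have h1 : s * (w * s) * (w ^ 2 * s) = s ^ 3 := by linear_combination s ^ 3 * hw3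
    rw [h1]
    match_scalars
    · ring
    · ring
    · linear_combination (-s) * hw
    · linear_combination (-s ^ 2 * w) * hw
  simp only [factor, det_mul, h]

/-- A unital linear map preserving the determinant preserves squares. -/
theorem map_mul_self_of_det_map_eq (φ : Matrix n n ℂ ≃ₗ[ℂ] Matrix n n ℂ) (h1 : φ 1 = 1)
    (hφ : ∀ X, (φ X).det = X.det) (X : Matrix n n ℂ) : φ (X * X) = φ X * φ X := by
  have hdet (Y : Matrix n n ℂ) (t : ℂ) : (1 + t • φ Y).det = (1 + t • Y).det := by
    rw [← hφ (1 + t • Y), map_add, map_smul, h1]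
  have sq (Y) := trace_sq_eq_of_det_one_add_smul_eq (hdet Y)
  have cube (Y) := trace_cube_eq_of_det_one_add_smul_eq (hdet Y)
  have bilin (Y Z : Matrix n n ℂ) : (φ Y * φ Z).trace = (Y * Z).trace := by
    have h := sq (Y + Z)
    simp only [map_add, mul_add, add_mul, trace_add, sq] at h
    rw [trace_mul_comm (φ Z), trace_mul_comm Z Y] at h
    linear_combination h / 2
  have trilin (Y Z : Matrix n n ℂ) : (φ Y * φ Y * φ Z).trace = (Y * Y * Z).trace := by
    have expand (A B : Matrix n n ℂ) :
        ((A + B) * (A + B) * (A + B)).trace - ((A - B) * (A - B) * (A - B)).trace =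
          6 * (A * A * B).trace + 2 * (B * B * B).trace := by
      simp only [mul_add, add_mul, mul_sub, sub_mul, trace_add, trace_sub]
      rw [mul_assoc B, trace_mul_comm B (A * A), trace_mul_comm (A * B) A, ← mul_assoc]
      ring
    have h := expand (φ Y) (φ Z)
    rw [← map_add, ← map_sub, cube, cube, expand, cube] at h
    linear_combination -h / 6
  refine ext_iff_trace_mul_right.2 fun Z => ?_
  obtain ⟨Z, rfl⟩ := φ.surjective Z
  rw [bilin, trilin]

/-- The full matrix algebra is prime, in a symmetrized form. -/
theorem eq_zero_or_eq_zero_of_mul_mul_add_mul_mul_eq_zero {A B : Matrix n n ℂ}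
    (h : ∀ C, A * C * B + B * C * A = 0) : A = 0 ∨ B = 0 := by
  have entry (i j k l) : A i j * B k l + B i j * A k l = 0 := by
    have := congrFun (congrFun (h (single j k 1)) i) l
    simpa [Matrix.mul_apply, single_apply, ite_and, Finset.sum_ite_eq, mul_assoc] using this
  by_contra! hAB
  obtain ⟨i, j, hA⟩ : ∃ i j, A i j ≠ 0 := by
    by_contra! hc
    exact hAB.1 (Matrix.ext hc)
  have hB : B i j = 0 := by
    have := entry i j i j
    have h2 : A i j * B i j = 0 := by linear_combination this / 2
    exact (mul_eq_zero.1 h2).resolve_left hA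
  refine hAB.2 (Matrix.ext fun k l => ?_)
  have := entry i j k l
  rw [hB, zero_mul, add_zero] at this
  exact (mul_eq_zero.1 this).resolve_left hA

end Matrix

theorem LinearMap.eq_zero_or_eq_zero_of_forall {R M N P : Type*} [Semiring R] [AddCommMonoid M]
    [AddCommMonoid N] [AddCommMonoid P] [Module R M] [Module R N] [Module R P]
    (f : M →ₗ[R] N) (g : M →ₗ[R] P) (h : ∀ x, f x = 0 ∨ g x = 0) : f = 0 ∨ g = 0 := by
  by_contra! hfg
  obtain ⟨x, hx⟩ := DFunLike.ne_iff.1 hfg.1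
  obtain ⟨y, hy⟩ := DFunLike.ne_iff.1 hfg.2
  have hgx := (h x).resolve_left hx
  have hfy := (h y).resolve_right hy
  rcases h (x + y) with hs | hs
  · exact hx (by simpa [hfy] using hs)
  · exact hy (by simpa [hgx] using hs)

namespace LinearMap

variable {R S : Type*} [Ring R] [Ring S] [Algebra ℂ R] [Algebra ℂ S] {φ : R →ₗ[ℂ] S}

theorem map_mul_add_mul_of_map_mul_self (hφ : ∀ a, φ (a * a) = φ a * φ a) (a b : R) :
    φ (a * b) + φ (b * a) = φ a * φ b + φ b * φ a := by
  have h := hφ (a + b)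
  simp only [map_add, mul_add, add_mul, hφ] at h
  linear_combination (norm := noncomm_ring) h

theorem map_mul_mul_self_of_map_mul_self (hφ : ∀ a, φ (a * a) = φ a * φ a) (a b : R) :
    φ (a * b * a) = φ a * φ b * φ a := by
  have h := map_mul_add_mul_of_map_mul_self hφ
  have hab := h a b
  have h1 := h a (a * b + b * a)
  rw [map_add, hab] at h1
  simp only [mul_add, add_mul, map_add, ← mul_assoc] at h1
  have h2 := h (a * a) b
  rw [hφ, ← mul_assoc] at h2
  have h3 : (2 : ℂ) • φ (a * b * a) = (2 : ℂ) • (φ a * φ b * φ a) := by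
    rw [two_smul, two_smul]
    linear_combination (norm := noncomm_ring) h1 - h2
  exact smul_right_injective S two_ne_zero h3

theorem map_mul_mul_add_of_map_mul_self (hφ : ∀ a, φ (a * a) = φ a * φ a) (a b c : R) :
    φ (a * b * c) + φ (c * b * a) = φ a * φ b * φ c + φ c * φ b * φ a := by
  have h := map_mul_mul_self_of_map_mul_self hφ
  have hac := h (a + c) b
  simp only [mul_add, add_mul, map_add, h] at hac
  linear_combination (norm := noncomm_ring) hac

theorem mul_mul_add_mul_mul_eq_zero_of_map_mul_self (hφ : ∀ a, φ (a * a) = φ a * φ a)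
    (a b c : R) :
    (φ (a * b) - φ a * φ b) * φ c * (φ (a * b) - φ b * φ a) +
      (φ (a * b) - φ b * φ a) * φ c * (φ (a * b) - φ a * φ b) = 0 := by
  have h := map_mul_mul_self_of_map_mul_self hφ
  have h1 := map_mul_mul_add_of_map_mul_self hφ (a * b) c (b * a)
  have h2 : φ (a * b * c * (b * a)) = φ a * (φ b * φ c * φ b) * φ a := by
    rw [← h, ← h]
    simp only [mul_assoc]
  have h3 : φ (b * a * c * (a * b)) = φ b * (φ a * φ c * φ a) * φ b := by
    rw [← h, ← h]
    simp only [mul_assoc]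
  have h4 : φ (b * a) = φ a * φ b + φ b * φ a - φ (a * b) :=
    eq_sub_of_add_eq' (map_mul_add_mul_of_map_mul_self hφ a b)
  rw [h2, h3, h4] at h1
  linear_combination (norm := noncomm_ring) h1

end LinearMap

namespace Matrix

variable {n : Type*} [Fintype n] [DecidableEq n]

/-- A Jordan automorphism of a full matrix algebra is multiplicative or antimultiplicative. -/
theorem map_mul_or_map_mul_rev_of_map_mul_self {φ : Matrix n n ℂ ≃ₗ[ℂ] Matrix n n ℂ}
    (hφ : ∀ X, φ (X * X) = φ X * φ X) :
    (∀ X Y, φ (X * Y) = φ X * φ Y) ∨ (∀ X Y, φ (X * Y) = φ Y * φ X) := by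
  let M := LinearMap.mul ℂ (Matrix n n ℂ)
  let f := M.compr₂ φ.toLinearMap - M.compl₁₂ φ.toLinearMap φ.toLinearMap
  let g := M.compr₂ φ.toLinearMap - M.flip.compl₁₂ φ.toLinearMap φ.toLinearMap
  have hf (X Y) : f X Y = φ (X * Y) - φ X * φ Y := rfl
  have hg (X Y) : g X Y = φ (X * Y) - φ Y * φ X := rfl
  have pointwise (X Y) : f X Y = 0 ∨ g X Y = 0 := by
    rw [hf, hg]
    refine eq_zero_or_eq_zero_of_mul_mul_add_mul_mul_eq_zero fun C => ?_
    obtain ⟨C, rfl⟩ := φ.surjective C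
    exact LinearMap.mul_mul_add_mul_mul_eq_zero_of_map_mul_self (φ := φ.toLinearMap) hφ X Y C
  rcases LinearMap.eq_zero_or_eq_zero_of_forall f g fun X =>
    LinearMap.eq_zero_or_eq_zero_of_forall (f X) (g X) (pointwise X) with h | h
  · exact .inl fun X Y => sub_eq_zero.1 (by rw [← hf, h]; rfl)
  · exact .inr fun X Y => sub_eq_zero.1 (by rw [← hg, h]; rfl)

/-- Every multiplicative linear automorphism of a full matrix algebra is inner. -/
theorem exists_map_eq_mul_mul_of_map_mul (φ : Matrix n n ℂ ≃ₗ[ℂ] Matrix n n ℂ)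
    (h1 : φ 1 = 1) (hφ : ∀ X Y, φ (X * Y) = φ X * φ Y) :
    ∃ P Q : Matrix n n ℂ, P * Q = 1 ∧ ∀ X, φ X = P * X * Q := by
  let e : Module.End ℂ (n → ℂ) ≃ₐ[ℂ] Module.End ℂ (n → ℂ) :=
    (toLinAlgEquiv'.symm.trans (AlgEquiv.ofLinearEquiv φ h1 hφ)).trans toLinAlgEquiv'
  obtain ⟨T, hT⟩ := e.eq_linearEquivConjAlgEquiv
  refine ⟨LinearMap.toMatrix' T.toLinearMap, LinearMap.toMatrix' T.symm.toLinearMap, ?_,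
    fun X => ?_⟩
  · rw [← LinearMap.toMatrix'_comp]
    simp
  · have h : toLin' (φ X) = T.toLinearMap ∘ₗ toLin' X ∘ₗ T.symm.toLinearMap :=
      (congrArg (fun Y => toLin' (φ Y)) (toLinAlgEquiv'.symm_apply_apply X)).symm.trans
        (DFunLike.congr_fun hT (toLinAlgEquiv' X))
    rw [← LinearMap.toMatrix'_toLin' (φ X), h, LinearMap.toMatrix'_comp,
      LinearMap.toMatrix'_comp, LinearMap.toMatrix'_toLin', mul_assoc]

/-- Two matrices inverse to each other can be rescaled to have determinant one. -/
theorem exists_det_eq_one_of_mul_eq_one [Nonempty n] {P Q : Matrix n n ℂ} (h : P * Q = 1) :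
    ∃ A B : Matrix n n ℂ, A.det = 1 ∧ B.det = 1 ∧ ∀ X, A * X * B = P * X * Q := by
  have hdet : P.det * Q.det = 1 := by rw [← det_mul, h, det_one]
  obtain ⟨c, hc⟩ := IsAlgClosed.exists_pow_nat_eq Q.det (Fintype.card_pos (α := n))
  have hc0 : c ≠ 0 := by
    rintro rfl
    rw [zero_pow Fintype.card_ne_zero] at hc
    simp [← hc] at hdet
  refine ⟨c • P, c⁻¹ • Q, ?_, ?_, fun X => ?_⟩
  · rw [det_smul, hc, mul_comm, hdet]
  · rw [det_smul, inv_pow, hc, inv_mul_cancel₀ (right_ne_zero_of_mul_eq_one hdet)]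
  · rw [smul_mul, smul_mul, Matrix.mul_smul, smul_smul, mul_inv_cancel₀ hc0, one_smul]

end Matrix

/-- **Frobenius' theorem on the symmetries of the determinant**: if `g` is a ℂ-linear
automorphism of the space of `n × n` complex matrices preserving the determinant, then
there are `A, B ∈ SL_n(ℂ)` such that either `g(X) = A·X·B` for all `X`, or
`g(X) = A·Xᵀ·B` for all `X`. -/
theorem frobenius_det_symmetries (n : ℕ) (hn : 1 ≤ n)
    (g : Matrix (Fin n) (Fin n) ℂ ≃ₗ[ℂ] Matrix (Fin n) (Fin n) ℂ)
    (hg : ∀ X : Matrix (Fin n) (Fin n) ℂ, (g X).det = X.det) :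
    ∃ A B : Matrix (Fin n) (Fin n) ℂ, A.det = 1 ∧ B.det = 1 ∧
      ((∀ X, g X = A * X * B) ∨ (∀ X, g X = A * Xᵀ * B)) := by
  have : Nonempty (Fin n) := ⟨⟨0, hn⟩⟩
  have hG : (g 1).det = 1 := by rw [hg, det_one]
  have hu : IsUnit (g 1).det := by simp [hG]
  let μ : Matrix (Fin n) (Fin n) ℂ ≃ₗ[ℂ] Matrix (Fin n) (Fin n) ℂ :=
    { LinearMap.mulLeft ℂ (g 1)⁻¹ with
      invFun X := g 1 * X
      left_inv X := mul_nonsing_inv_cancel_left _ X hu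
      right_inv X := nonsing_inv_mul_cancel_left _ X hu }
  let φ := g.trans μ
  have hφ (X) : φ X = (g 1)⁻¹ * g X := rfl
  have hgφ (X) : g X = g 1 * φ X := by rw [hφ, mul_nonsing_inv_cancel_left _ _ hu]
  have hφ1 : φ 1 = 1 := by rw [hφ, nonsing_inv_mul _ hu]
  have hφdet (X) : (φ X).det = X.det := by
    rw [hφ, det_mul, det_nonsing_inv, hG, Ring.inverse_one, one_mul, hg]
  rcases map_mul_or_map_mul_rev_of_map_mul_self (map_mul_self_of_det_map_eq φ hφ1 hφdet)
    with h | h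
  · obtain ⟨P, Q, hPQ, hconj⟩ := exists_map_eq_mul_mul_of_map_mul φ hφ1 h
    obtain ⟨A, B, hA, hB, hAB⟩ := exists_det_eq_one_of_mul_eq_one hPQ
    refine ⟨g 1 * A, B, by rw [det_mul, hG, hA, one_mul], hB, .inl fun X => ?_⟩
    rw [hgφ, hconj, ← hAB]
    simp only [mul_assoc]
  · obtain ⟨P, Q, hPQ, hconj⟩ := exists_map_eq_mul_mul_of_map_mul
      ((transposeLinearEquiv (Fin n) (Fin n) ℂ ℂ).trans φ) (by simp [hφ1]) (by simp [h])
    obtain ⟨A, B, hA, hB, hAB⟩ := exists_det_eq_one_of_mul_eq_one hPQ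
    refine ⟨g 1 * A, B, by rw [det_mul, hG, hA, one_mul], hB, .inr fun X => ?_⟩
    have hX : φ X = P * Xᵀ * Q := hconj Xᵀ
    rw [hgφ, hX, ← hAB]
    simp only [mul_assoc]
end
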